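/- For every log-concave random variable X with mean 0 and every p ≥ 1, one has ‖X‖_p ≤ C_p · ‖X‖_1, where C_p = max{Γ(p+1)^{1/p}, (e/2)·‖ℰ−1‖_p} and ℰ is a standard exponential random variable. -/

import Mathlib

open MeasureTheory ProbabilityTheory Real Set

/-- `f` is a (nonnegative) log-concave function on `ℝ`. -/
def IsLogConcaveFn (f : ℝ → ℝ) : Prop :=
  (∀ x, 0 ≤ f x) ∧
  ∀ x y l : ℝ, 0 ≤ l → l ≤ 1 → f x ^ l * f y ^ (1 - l) ≤ f (l * x + (1 - l) * y)

/-- `X` has density `f` with respect to Lebesgue measure. -/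
def HasDensity {Ω : Type*} [MeasurableSpace Ω] (P : Measure Ω) (X : Ω → ℝ) (f : ℝ → ℝ) : Prop :=
  Measurable X ∧ Measure.map X P = volume.withDensity (fun x => ENNReal.ofReal (f x))

/-- The `L_p` "norm" of a random variable, with the geometric-mean convention at `p = 0`. -/
noncomputable def pNorm {Ω : Type*} [MeasurableSpace Ω] (P : Measure Ω) (X : Ω → ℝ) (p : ℝ) : ℝ :=
  if p = 0 then Real.exp (∫ ω, Real.log |X ω| ∂P)
  else (∫ ω, |X ω| ^ p ∂P) ^ (1 / p)

/-! ### Log-concave functions -/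

lemma IsLogConcaveFn.mul_exp {f : ℝ → ℝ} (hf : IsLogConcaveFn f) (k : ℝ) :
    IsLogConcaveFn (fun x => f x * exp (k * x)) := by
  refine ⟨fun x => mul_nonneg (hf.1 x) (exp_pos _).le, fun x y l h0 h1 => ?_⟩
  rw [mul_rpow (hf.1 x) (exp_pos _).le, mul_rpow (hf.1 y) (exp_pos _).le, ← exp_mul, ← exp_mul]
  calc f x ^ l * exp (k * x * l) * (f y ^ (1 - l) * exp (k * y * (1 - l)))
      = f x ^ l * f y ^ (1 - l) * (exp (k * x * l) * exp (k * y * (1 - l))) := by ring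
    _ = f x ^ l * f y ^ (1 - l) * exp (k * (l * x + (1 - l) * y)) := by
        rw [← exp_add]; ring_nf
    _ ≤ _ := mul_le_mul_of_nonneg_right (hf.2 x y l h0 h1) (exp_pos _).le

lemma IsLogConcaveFn.comp_mul {f : ℝ → ℝ} (hf : IsLogConcaveFn f) (k : ℝ) :
    IsLogConcaveFn (fun x => f (k * x)) := by
  refine ⟨fun x => hf.1 _, fun x y l h0 h1 => ?_⟩
  have := hf.2 (k * x) (k * y) l h0 h1
  convert this using 2
  ring

lemma IsLogConcaveFn.const_mul {f : ℝ → ℝ} (hf : IsLogConcaveFn f) {c : ℝ} (hc : 0 < c) :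
    IsLogConcaveFn (fun x => c * f x) := by
  refine ⟨fun x => mul_nonneg hc.le (hf.1 x), fun x y l h0 h1 => ?_⟩
  rw [mul_rpow hc.le (hf.1 x), mul_rpow hc.le (hf.1 y)]
  calc c ^ l * f x ^ l * (c ^ (1 - l) * f y ^ (1 - l))
      = (c ^ l * c ^ (1 - l)) * (f x ^ l * f y ^ (1 - l)) := by ring
    _ = c * (f x ^ l * f y ^ (1 - l)) := by
        rw [← rpow_add hc]; simp
    _ ≤ _ := mul_le_mul_of_nonneg_left (hf.2 x y l h0 h1) hc.le

/-- strict two point inequality -/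
lemma IsLogConcaveFn.lt_between {f : ℝ → ℝ} (hf : IsLogConcaveFn f) {c x y z : ℝ} (hc : 0 < c)
    (hx : c < f x) (hy : c ≤ f y) (hxz : x ≤ z) (hzy : z < y) : c < f z := by
  have hxy : 0 < y - x := by linarith
  set l := (y - z) / (y - x) with hl
  have l0 : 0 < l := div_pos (by linarith) hxy
  have l1 : l ≤ 1 := by rw [hl, div_le_one hxy]; linarith
  have key := hf.2 x y l l0.le l1
  have hz : l * x + (1 - l) * y = z := by
    rw [hl]; field_simp; ring
  rw [hz] at key
  refine lt_of_lt_of_le ?_ key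
  calc c = c ^ l * c ^ (1 - l) := by rw [← rpow_add hc]; simp
    _ < f x ^ l * c ^ (1 - l) := by
      apply mul_lt_mul_of_pos_right _ (rpow_pos_of_pos hc _)
      exact rpow_lt_rpow hc.le hx l0
    _ ≤ f x ^ l * f y ^ (1 - l) := by
      apply mul_le_mul_of_nonneg_left _ (rpow_nonneg (hf.1 x) _)
      exact rpow_le_rpow hc.le hy (by linarith)

lemma IsLogConcaveFn.ordConnected {f : ℝ → ℝ} (hf : IsLogConcaveFn f) (c : ℝ) :
    OrdConnected {x | c < f x} := by
  constructor
  intro x hx y hy z hz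
  simp only [mem_ofPred_eq] at *
  rcases lt_or_ge c 0 with hc | hc
  · exact lt_of_lt_of_le hc (hf.1 z)
  rcases hz.2.eq_or_lt with h | h
  · rwa [h]
  obtain ⟨d, hd1, hd2⟩ := exists_between (lt_min hx hy)
  have := hf.lt_between (c := d) (lt_of_le_of_lt hc hd1) (hd2.trans_le (min_le_left _ _))
    (hd2.le.trans (min_le_right _ _)) hz.1 h
  exact hd1.trans this

lemma IsLogConcaveFn.measurable {f : ℝ → ℝ} (hf : IsLogConcaveFn f) : Measurable f :=
  measurable_of_Ioi fun c => (hf.ordConnected c).measurableSet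

lemma lt_mul_exp_iff (c u k x : ℝ) : c * exp (-(k * x)) < u ↔ c < u * exp (k * x) := by
  rw [exp_neg, ← div_eq_mul_inv, div_lt_iff₀ (exp_pos _)]

lemma IsLogConcaveFn.ordConnected_exp {f : ℝ → ℝ} (hf : IsLogConcaveFn f) (c k : ℝ) :
    OrdConnected {x | c * exp (-(k * x)) < f x} := by
  have := (hf.mul_exp k).ordConnected c
  simpa only [lt_mul_exp_iff] using this

/-! ### The three-sign-pattern comparison -/

/-- If `d` has signs `-,+,-` on `(0,∞)` and vanishing zeroth and first moments, it integrates
to something nonpositive against `(x-t)_+`. -/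
lemma pattern_le {d : ℝ → ℝ} (hd : IntegrableOn d (Ioi 0)) (hxd : IntegrableOn (fun x => x * d x) (Ioi 0))
    (h0 : ∫ x in Ioi 0, d x = 0) (h1 : ∫ x in Ioi 0, x * d x = 0)
    (hE : OrdConnected {x : ℝ | 0 < x ∧ 0 < d x}) (t : ℝ)
    (hpd : IntegrableOn (fun x => max (x - t) 0 * d x) (Ioi 0)) :
    ∫ x in Ioi 0, max (x - t) 0 * d x ≤ 0 := by
  have main : ∃ A B : ℝ, ∀ x : ℝ, 0 < x → (max (x - t) 0 - (A + B * x)) * d x ≤ 0 := by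
    set E := {x : ℝ | 0 < x ∧ 0 < d x} with hEdef
    rcases E.eq_empty_or_nonempty with he | hne
    · refine ⟨0, 0, fun x hx => ?_⟩
      have : d x ≤ 0 := by
        by_contra h
        have : x ∈ E := ⟨hx, not_le.1 h⟩
        rw [he] at this; exact this
      have h2 : 0 ≤ max (x - t) 0 := le_max_right _ _
      nlinarith
    have hbelow : BddBelow E := ⟨0, fun x hx => hx.1.le⟩
    have hlo : ∀ x, 0 < x → x < sInf E → d x ≤ 0 := by
      intro x hx hlt
      by_contra h
      exact absurd (csInf_le hbelow (show x ∈ E from ⟨hx, not_le.1 h⟩)) (not_le.2 hlt)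
    by_cases hb : BddAbove E
    · have hhi : ∀ x, 0 < x → sSup E < x → d x ≤ 0 := by
        intro x hx hlt
        by_contra h
        exact absurd (le_csSup hb (show x ∈ E from ⟨hx, not_le.1 h⟩)) (not_le.2 hlt)
      have hmid : ∀ x, sInf E < x → x < sSup E → 0 < d x := by
        intro x h1 h2
        obtain ⟨u, hu, hux⟩ := exists_lt_of_csInf_lt hne h1
        obtain ⟨v, hv, hxv⟩ := exists_lt_of_lt_csSup hne h2
        exact (hE.out hu hv ⟨hux.le, hxv.le⟩).2
      set y1 := sInf E
      set y2 := sSup E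
      have h12 : y1 ≤ y2 := csInf_le_csSup hne hbelow hb
      rcases h12.eq_or_lt with h12 | h12
      · by_cases hyt : t ≤ y1
        · refine ⟨-t, 1, fun x hx => ?_⟩
          rcases lt_trichotomy x y1 with h | h | h
          · have := hlo x hx h
            have h3 := le_max_left (x - t) 0
            nlinarith
          · rw [max_eq_left (by linarith)]
            have : x - t - (-t + 1 * x) = 0 := by ring
            rw [this]; simp
          · have := hhi x hx (by linarith)
            have h3 := le_max_left (x - t) 0
            nlinarith
        · refine ⟨0, 0, fun x hx => ?_⟩
          have h3 := le_max_right (x - t) 0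
          rcases lt_trichotomy x y1 with h | h | h
          · have := hlo x hx h
            nlinarith
          · rw [max_eq_right (by linarith)]
            simp
          · have := hhi x hx (by linarith)
            nlinarith
      · set k := (max (y2 - t) 0 - max (y1 - t) 0) / (y2 - y1) with hk
        have hk' : k * (y2 - y1) = max (y2 - t) 0 - max (y1 - t) 0 := by
          rw [hk]; field_simp [(sub_pos.2 h12).ne']
        have hcv : ConvexOn ℝ univ (fun x : ℝ => max (x - t) 0) :=
          (((convexOn_id convex_univ).add_const (-t)).sup (convexOn_const 0 convex_univ))
        refine ⟨max (y1 - t) 0 - k * y1, k, fun x hx => ?_⟩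
        rcases lt_trichotomy x y1 with h | h | h
        · have hd' := hlo x hx h
          have := hcv.slope_mono_adjacent (mem_univ x) (mem_univ y2) h h12
          rw [← hk, div_le_iff₀ (by linarith)] at this
          nlinarith
        · have : max (x - t) 0 - (max (y1 - t) 0 - k * y1 + k * x) = 0 := by rw [h]; ring
          rw [this]; simp
        rcases lt_trichotomy x y2 with h' | h' | h'
        · have hd' := hmid x h h'
          have := hcv.secant_mono (a := y1) (mem_univ y1) (mem_univ x) (mem_univ y2) h.ne' h12.ne' h'.le
          rw [← hk, div_le_iff₀ (by linarith)] at this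
          nlinarith
        · have : max (x - t) 0 - (max (y1 - t) 0 - k * y1 + k * x) = 0 := by rw [h']; linarith
          rw [this]; simp
        · have hd' := hhi x hx h'
          have := hcv.slope_mono_adjacent (mem_univ y1) (mem_univ x) h12 h'
          rw [← hk, le_div_iff₀ (by linarith)] at this
          nlinarith
    · have hhi : ∀ x, sInf E < x → 0 < d x := by
        intro x h1
        obtain ⟨u, hu, hux⟩ := exists_lt_of_csInf_lt hne h1
        obtain ⟨v, hv, hxv⟩ := not_bddAbove_iff.1 hb x
        exact (hE.out hu hv ⟨hux.le, hxv.le⟩).2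
      set y1 := sInf E
      refine ⟨max (y1 - t) 0 - y1, 1, fun x hx => ?_⟩
      rcases lt_trichotomy x y1 with h | h | h
      · have := hlo x hx h
        have : max (x - t) 0 ≥ max (y1 - t) 0 - (y1 - x) := by
          rcases max_cases (x - t) 0 with h | h <;> rcases max_cases (y1 - t) 0 with h' | h' <;> linarith
        nlinarith
      · have : max (x - t) 0 - (max (y1 - t) 0 - y1 + 1 * x) = 0 := by rw [h]; ring
        rw [this]; simp
      · have := hhi x h
        have : max (x - t) 0 ≤ max (y1 - t) 0 - (y1 - x) := by
          rcases max_cases (x - t) 0 with h | h <;> rcases max_cases (y1 - t) 0 with h' | h' <;> linarith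
        nlinarith
  obtain ⟨A, B, hAB⟩ := main
  have e1 : ∫ x in Ioi 0, max (x - t) 0 * d x =
      ∫ x in Ioi 0, (max (x - t) 0 - (A + B * x)) * d x := by
    have : ∀ x, (max (x - t) 0 - (A + B * x)) * d x
        = max (x - t) 0 * d x - (A * d x + B * (x * d x)) := fun x => by ring
    simp_rw [this]
    have hs : IntegrableOn (fun x => A * d x + B * (x * d x)) (Ioi 0) :=
      (hd.const_mul A).add (hxd.const_mul B)
    rw [integral_sub hpd hs,
      integral_add (hd.const_mul A) (hxd.const_mul B), integral_const_mul, integral_const_mul, h0, h1]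
    simp
  rw [e1]
  exact setIntegral_nonpos measurableSet_Ioi fun x hx => hAB x hx

/-! ### The extremal family -/

noncomputable def ww (s : ℝ) : ℝ := (2 - s) * exp s / 2

noncomputable def qq (τ u : ℝ) : ℝ := if τ ≤ 0 then 0 else exp (-u / τ)

noncomputable def SS (s y : ℝ) : ℝ :=
  if y ≤ s then exp y / 2 - ww s * y else exp s * (1 - s) ^ 2 / 2 * qq (1 - s) (y - s)

noncomputable def gam (s x : ℝ) : ℝ :=
  if x ≤ s then exp x else exp s * qq (1 - s) (x - s)

lemma qq_nonneg (τ u : ℝ) : 0 ≤ qq τ u := by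
  unfold qq; split_ifs
  · exact le_rfl
  · exact (exp_pos _).le

lemma tau_qq_zero {τ : ℝ} (hτ : 0 ≤ τ) : τ * qq τ 0 = τ := by
  unfold qq; split_ifs with h
  · have : τ = 0 := le_antisymm h hτ
    simp [this]
  · simp

open Filter Topology in
lemma tendsto_lin_exp {τ : ℝ} (hτ : 0 < τ) (A B s : ℝ) :
    Tendsto (fun x => (A * x + B) * exp (-(x - s) / τ)) atTop (𝓝 0) := by
  have hu : Tendsto (fun x : ℝ => (x - s) / τ) atTop atTop :=
    (tendsto_atTop_add_const_right atTop (-s) tendsto_id).atTop_div_const hτ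
  have h1 := (tendsto_pow_mul_exp_neg_atTop_nhds_zero 1).comp hu
  have h0 := (tendsto_pow_mul_exp_neg_atTop_nhds_zero 0).comp hu
  have := (h1.const_mul (A * τ)).add (h0.const_mul (A * s + B))
  simp only [mul_zero, add_zero] at this
  refine this.congr fun x => ?_
  simp only [Function.comp, pow_one, pow_zero]
  rw [neg_div]
  field_simp
  ring

lemma expint {τ c d s : ℝ} (hτ : 0 < τ) (hd : d ≤ c) :
    IntegrableOn (fun x => (x - d) * exp (-(x - s) / τ)) (Ioi c) ∧
    ∫ x in Ioi c, (x - d) * exp (-(x - s) / τ) = (τ * (c - d) + τ ^ 2) * exp (-(c - s) / τ) := by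
  have hder : ∀ x : ℝ, HasDerivAt (fun x => (-τ * x + (τ * d - τ ^ 2)) * exp (-(x - s) / τ))
      ((x - d) * exp (-(x - s) / τ)) x := by
    intro x
    have h1 : HasDerivAt (fun x => -τ * x + (τ * d - τ ^ 2)) (-τ) x := by
      simpa using ((hasDerivAt_id x).const_mul (-τ)).add_const (τ * d - τ ^ 2)
    have h2 : HasDerivAt (fun x => exp (-(x - s) / τ)) (exp (-(x - s) / τ) * (-1 / τ)) x := by
      have := (((hasDerivAt_id x).sub_const s).neg.div_const τ).exp
      simpa using this
    refine (h1.mul h2).congr_deriv ?_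
    field_simp
    ring
  have hT := tendsto_lin_exp hτ (-τ) (τ * d - τ ^ 2) s
  have hpos : ∀ x ∈ Ioi c, 0 ≤ (x - d) * exp (-(x - s) / τ) := fun x hx =>
    mul_nonneg (by have : c < x := hx; linarith) (exp_pos _).le
  refine ⟨integrableOn_Ioi_deriv_of_nonneg' (fun x _ => hder x) hpos hT, ?_⟩
  rw [integral_Ioi_of_hasDerivAt_of_nonneg' (fun x _ => hder x) hpos hT]
  ring

lemma expint0 {τ c s : ℝ} (hτ : 0 < τ) :
    IntegrableOn (fun x => exp (-(x - s) / τ)) (Ioi c) ∧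
    ∫ x in Ioi c, exp (-(x - s) / τ) = τ * exp (-(c - s) / τ) := by
  have hder : ∀ x : ℝ, HasDerivAt (fun x => (0 * x + (-τ)) * exp (-(x - s) / τ))
      (exp (-(x - s) / τ)) x := by
    intro x
    have h2 : HasDerivAt (fun x => exp (-(x - s) / τ)) (exp (-(x - s) / τ) * (-1 / τ)) x := by
      have := (((hasDerivAt_id x).sub_const s).neg.div_const τ).exp
      simpa using this
    simp only [zero_mul, zero_add]
    refine (h2.const_mul (-τ)).congr_deriv ?_
    field_simp
  have hT := tendsto_lin_exp hτ 0 (-τ) s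
  have hpos : ∀ x ∈ Ioi c, 0 ≤ exp (-(x - s) / τ) := fun x hx => (exp_pos _).le
  refine ⟨integrableOn_Ioi_deriv_of_nonneg' (fun x _ => hder x) hpos hT, ?_⟩
  rw [integral_Ioi_of_hasDerivAt_of_nonneg' (fun x _ => hder x) hpos hT]
  ring

lemma qint {τ c d s : ℝ} (hτ : 0 ≤ τ) (hd : d ≤ c) :
    IntegrableOn (fun x => (x - d) * qq τ (x - s)) (Ioi c) ∧
    ∫ x in Ioi c, (x - d) * qq τ (x - s) = (τ * (c - d) + τ ^ 2) * qq τ (c - s) := by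
  rcases hτ.eq_or_lt with rfl | h
  · simp [qq]
  · simp only [qq, not_le.2 h, if_false]
    exact expint h hd

lemma qint0 {τ c s : ℝ} (hτ : 0 ≤ τ) :
    IntegrableOn (fun x => qq τ (x - s)) (Ioi c) ∧
    ∫ x in Ioi c, qq τ (x - s) = τ * qq τ (c - s) := by
  rcases hτ.eq_or_lt with rfl | h
  · simp [qq]
  · simp only [qq, not_le.2 h, if_false]
    exact expint0 h

lemma integral_max {t : ℝ} (ht : 0 ≤ t) (φ : ℝ → ℝ) :
    ∫ x in Ioi 0, max (x - t) 0 * φ x = ∫ x in Ioi t, (x - t) * φ x := by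
  rw [setIntegral_eq_of_subset_of_forall_sdiff_eq_zero measurableSet_Ioi (Ioi_subset_Ioi ht)]
  · refine setIntegral_congr_fun measurableSet_Ioi fun x hx => ?_
    have : t < x := hx
    rw [max_eq_left (by linarith)]
  · intro x hx
    have : x ≤ t := not_lt.1 hx.2
    rw [max_eq_right (by linarith)]; simp

lemma integrable_max {t : ℝ} {φ : ℝ → ℝ} (h1 : IntegrableOn φ (Ioi 0))
    (h2 : IntegrableOn (fun x => x * φ x) (Ioi 0)) :
    IntegrableOn (fun x => max (x - t) 0 * φ x) (Ioi 0) := by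
  refine Integrable.mono' ((h2.norm).add (h1.norm.const_mul |t|)) ?_ ?_
  · exact (by fun_prop : Continuous fun x : ℝ => max (x - t) 0).aestronglyMeasurable.mul
      h1.aestronglyMeasurable
  · filter_upwards with x
    simp only [Pi.add_apply, norm_mul, Real.norm_eq_abs]
    have : |max (x - t) 0| ≤ |x| + |t| := by
      rw [abs_of_nonneg (le_max_right _ _)]
      apply max_le
      · have := le_abs_self x; have := neg_abs_le t; linarith
      · positivity
    nlinarith [abs_nonneg (φ x)]

lemma hasDerivAt_lin_exp (t x : ℝ) :
    HasDerivAt (fun x => (x - t - 1) * exp x) ((x - t) * exp x) x := by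
  have h1 : HasDerivAt (fun x : ℝ => x - t - 1) 1 x :=
    ((hasDerivAt_id x).sub_const t).sub_const 1
  refine (h1.mul (Real.hasDerivAt_exp x)).congr_deriv ?_
  ring

lemma gam_tail {s : ℝ} (h1 : s ≤ 1) {d c : ℝ} (hc : s ≤ c) (hd : d ≤ c) :
    IntegrableOn (fun x => (x - d) * gam s x) (Ioi c) ∧
    ∫ x in Ioi c, (x - d) * gam s x
      = exp s * (((1 - s) * (c - d) + (1 - s) ^ 2) * qq (1 - s) (c - s)) := by
  have hc' : ∀ x ∈ Ioi c, exp s * ((x - d) * qq (1 - s) (x - s)) = (x - d) * gam s x := by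
    intro x hx
    have : s < x := lt_of_le_of_lt hc hx
    simp only [gam, not_le.2 this, if_false]; ring
  obtain ⟨i1, i2⟩ := qint (τ := 1 - s) (s := s) (by linarith) hd
  refine ⟨IntegrableOn.congr_fun (MeasureTheory.Integrable.const_mul i1 (exp s) : IntegrableOn _ (Ioi _) volume) hc' measurableSet_Ioi, ?_⟩
  rw [← setIntegral_congr_fun measurableSet_Ioi hc', integral_const_mul, i2]

lemma gam_int {s : ℝ} (h0 : 0 ≤ s) (h1 : s ≤ 1) :
    IntegrableOn (gam s) (Ioi 0) ∧ ∫ x in Ioi 0, gam s x = 2 * ww s - 1 := by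
  have hu : Ioi (0:ℝ) = Ioc 0 s ∪ Ioi s := (Ioc_union_Ioi_eq_Ioi h0).symm
  have hc1 : ∀ x ∈ Ioc 0 s, exp x = gam s x := fun x hx => by simp [gam, hx.2]
  have hc2 : ∀ x ∈ Ioi s, exp s * qq (1 - s) (x - s) = gam s x := fun x hx => by
    simp only [gam, not_le.2 (show s < x from hx), if_false]
  obtain ⟨i1, i2⟩ := qint0 (τ := 1 - s) (s := s) (c := s) (by linarith)
  have j1 : IntegrableOn (gam s) (Ioc 0 s) :=
    ((continuous_exp.integrableOn_Icc).mono_set Ioc_subset_Icc_self).congr_fun hc1 measurableSet_Ioc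
  have j2 : IntegrableOn (gam s) (Ioi s) :=
    IntegrableOn.congr_fun (MeasureTheory.Integrable.const_mul i1 (exp s) : IntegrableOn _ (Ioi _) volume) hc2 measurableSet_Ioi
  refine ⟨by rw [hu]; exact j1.union j2, ?_⟩
  rw [hu, setIntegral_union (Ioc_disjoint_Ioi le_rfl) measurableSet_Ioi j1 j2,
    ← setIntegral_congr_fun measurableSet_Ioc hc1, ← setIntegral_congr_fun measurableSet_Ioi hc2,
    integral_const_mul, i2, ← intervalIntegral.integral_of_le h0, integral_exp, sub_self,
    tau_qq_zero (by linarith), exp_zero]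
  unfold ww; ring

lemma gam_int1 {s : ℝ} (h0 : 0 ≤ s) (h1 : s ≤ 1) {t : ℝ} (ht : 0 ≤ t) :
    IntegrableOn (fun x => (x - t) * gam s x) (Ioi t) ∧
    ∫ x in Ioi t, (x - t) * gam s x = 2 * SS s t := by
  by_cases hts : t ≤ s
  · have hu : Ioi t = Ioc t s ∪ Ioi s := (Ioc_union_Ioi_eq_Ioi hts).symm
    have hc1 : ∀ x ∈ Ioc t s, (x - t) * exp x = (x - t) * gam s x := fun x hx => by simp [gam, hx.2]
    obtain ⟨j2, i2⟩ := gam_tail h1 le_rfl hts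
    have j1 : IntegrableOn (fun x => (x - t) * gam s x) (Ioc t s) :=
      (((by fun_prop : Continuous fun x : ℝ => (x - t) * exp x).integrableOn_Icc).mono_set
        Ioc_subset_Icc_self).congr_fun hc1 measurableSet_Ioc
    refine ⟨by rw [hu]; exact j1.union j2, ?_⟩
    rw [hu, setIntegral_union (Ioc_disjoint_Ioi le_rfl) measurableSet_Ioi j1 j2,
      ← setIntegral_congr_fun measurableSet_Ioc hc1, i2, ← intervalIntegral.integral_of_le hts,
      intervalIntegral.integral_eq_sub_of_hasDerivAt (fun x _ => hasDerivAt_lin_exp t x)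
        ((by fun_prop : Continuous fun x : ℝ => (x - t) * exp x).intervalIntegrable _ _)]
    have := tau_qq_zero (τ := 1 - s) (by linarith)
    have e : exp s * (((1 - s) * (s - t) + (1 - s) ^ 2) * qq (1 - s) (s - s))
        = exp s * ((s - t) + (1 - s)) * ((1 - s) * qq (1 - s) 0) := by rw [sub_self]; ring
    rw [e, this]
    simp only [SS, hts, if_true]
    unfold ww; ring
  · obtain ⟨j, i⟩ := gam_tail (s := s) h1 (not_le.1 hts).le (le_refl t)
    refine ⟨j, ?_⟩
    rw [i]
    simp only [SS, hts, if_false]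
    ring

/-! ### Comparison with the extremal densities -/

lemma cmp_le {u g : ℝ → ℝ} (hu : IntegrableOn u (Ioi 0)) (hxu : IntegrableOn (fun x => x * u x) (Ioi 0))
    (hg : IntegrableOn g (Ioi 0)) (hxg : IntegrableOn (fun x => x * g x) (Ioi 0))
    (h0 : ∫ x in Ioi 0, u x = ∫ x in Ioi 0, g x)
    (h1 : ∫ x in Ioi 0, x * u x = ∫ x in Ioi 0, x * g x)
    (hE : OrdConnected {x : ℝ | 0 < x ∧ g x < u x}) (t : ℝ) :
    ∫ x in Ioi 0, max (x - t) 0 * u x ≤ ∫ x in Ioi 0, max (x - t) 0 * g x := by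
  have hd : IntegrableOn (fun x => u x - g x) (Ioi 0) := hu.sub hg
  have hxd : IntegrableOn (fun x => x * (u x - g x)) (Ioi 0) := by
    simp only [mul_sub]; exact hxu.sub hxg
  have := pattern_le hd hxd (by rw [integral_sub hu hg, h0, sub_self])
    (by simp only [mul_sub]; rw [integral_sub hxu hxg, h1, sub_self])
    (by simpa only [sub_pos] using hE) t (integrable_max hd hxd)
  simp only [mul_sub] at this
  rw [integral_sub (integrable_max hu hxu) (integrable_max hg hxg)] at this
  linarith

lemma exp_data (α : ℝ) : IntegrableOn (fun x => α * exp (-x)) (Ioi 0) ∧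
    IntegrableOn (fun x => x * (α * exp (-x))) (Ioi 0) ∧
    ∫ x in Ioi 0, α * exp (-x) = α ∧ ∫ x in Ioi 0, x * (α * exp (-x)) = α := by
  obtain ⟨a1, a2⟩ := expint0 (τ := 1) (c := 0) (s := 0) one_pos
  obtain ⟨b1, b2⟩ := expint (τ := 1) (c := 0) (d := 0) (s := 0) one_pos le_rfl
  simp only [sub_zero, div_one, neg_zero, exp_zero, mul_one, mul_zero, zero_add, one_pow] at a1 a2 b1 b2
  have e : (fun x : ℝ => x * (α * exp (-x))) = fun x => α * (x * exp (-x)) := by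
    funext x; ring
  rw [e]
  refine ⟨a1.const_mul α, b1.const_mul α, ?_, ?_⟩
  · rw [integral_const_mul, a2, mul_one]
  · rw [integral_const_mul, b2, mul_one]

lemma right_le {f : ℝ → ℝ} (hf : IsLogConcaveFn f) {α : ℝ} (hi : IntegrableOn f (Ioi 0))
    (hxi : IntegrableOn (fun x => x * f x) (Ioi 0)) (h0 : ∫ x in Ioi 0, f x = α)
    (h1 : ∫ x in Ioi 0, x * f x = α) {t : ℝ} (ht : 0 ≤ t) :
    ∫ x in Ioi 0, max (x - t) 0 * f x ≤ α * exp (-t) := by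
  obtain ⟨a, b, c, d⟩ := exp_data α
  have := cmp_le hi hxi a b (by rw [h0, c]) (by rw [h1, d]) (by
    have := (ordConnected_Ioi (a := (0:ℝ))).inter (hf.ordConnected_exp α 1)
    simp only [one_mul] at this; exact this) t
  refine this.trans_eq ?_
  rw [integral_max ht]
  have e : (fun x : ℝ => (x - t) * (α * exp (-x))) = fun x => α * ((x - t) * exp (-x)) := by
    funext x; ring
  rw [e, integral_const_mul]
  have := (expint (τ := 1) (c := t) (d := t) (s := 0) one_pos le_rfl).2
  simp only [sub_zero, div_one, sub_self, mul_zero, zero_add, one_pow, one_mul] at this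
  rw [this]

lemma left_bound {f : ℝ → ℝ} (hf : IsLogConcaveFn f) {α : ℝ} (hα : 0 < α) (hi : IntegrableOn f (Ioi 0))
    (hxi : IntegrableOn (fun x => x * f x) (Ioi 0)) (h0 : ∫ x in Ioi 0, f x = α)
    (h1 : ∫ x in Ioi 0, x * f x = α) {x : ℝ} (hx : x ≤ 0) : f x ≤ α * exp (-x) := by
  by_contra hcon
  rw [not_le] at hcon
  have hg := hf.mul_exp 1
  obtain ⟨a, b, c, d⟩ := exp_data α
  have iff (z : ℝ) : α * exp (-z) < f z ↔ α < f z * exp (1 * z) := by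
    simpa using lt_mul_exp_iff α (f z) 1 z
  have iff2 (z : ℝ) : f z < α * exp (-z) ↔ f z * exp (1 * z) < α := by
    rw [exp_neg, ← div_eq_mul_inv, lt_div_iff₀ (exp_pos _), one_mul]
  have hlt : ∀ z y : ℝ, 0 < z → z < y → α ≤ f y * exp (1 * y) → α * exp (-z) < f z := by
    intro z y hz hzy hy
    exact (iff z).2 (hg.lt_between hα ((iff x).1 hcon) hy (by linarith) hzy)
  set D : ℝ → ℝ := fun z => f z - α * exp (-z) with hD
  have hDi : IntegrableOn D (Ioi 0) := hi.sub a
  have hxDi : IntegrableOn (fun z => z * D z) (Ioi 0) := by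
    simp only [hD, mul_sub]; exact hxi.sub b
  have hD0 : ∫ z in Ioi 0, D z = 0 := by
    simp only [hD]; rw [integral_sub hi a, h0, c, sub_self]
  have hD1 : ∫ z in Ioi 0, z * D z = 0 := by
    simp only [hD, mul_sub]; rw [integral_sub hxi b, h1, d, sub_self]
  have main : ∃ A B y : ℝ, ∀ z : ℝ, 0 < z → z ≠ y → 0 < (A + B * z) * D z := by
    set E := {z : ℝ | α ≤ f z * exp (1 * z)} with hE
    by_cases hb : BddAbove E
    · refine ⟨sSup E, -1, sSup E, fun z hz hne => ?_⟩
      rcases lt_or_gt_of_ne hne with h | h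
      · obtain ⟨y, hy, hzy⟩ := exists_lt_of_lt_csSup ⟨x, ((iff x).1 hcon).le⟩ h
        have := hlt z y hz hzy hy
        exact mul_pos (by linarith) (sub_pos.2 this)
      · have : z ∉ E := fun hzE => absurd (le_csSup hb hzE) (not_le.2 h)
        have := (iff2 z).2 (not_le.1 this)
        exact mul_pos_of_neg_of_neg (by linarith) (sub_neg.2 this)
    · refine ⟨1, 0, 0, fun z hz _ => ?_⟩
      rw [not_bddAbove_iff] at hb
      obtain ⟨y, hy, hzy⟩ := hb z
      have := hlt z y hz hzy hy
      exact mul_pos (by linarith) (sub_pos.2 this)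
  obtain ⟨A, B, y, hpos⟩ := main
  have hI : IntegrableOn (fun z => (A + B * z) * D z) (Ioi 0) := by
    have := (hDi.const_mul A).add (hxDi.const_mul B)
    refine this.congr ?_
    filter_upwards with z
    simp only [Pi.add_apply]; ring
  have hz : ∫ z in Ioi 0, (A + B * z) * D z = 0 := by
    have : ∀ z, (A + B * z) * D z = A * D z + B * (z * D z) := fun z => by ring
    simp only [this]
    rw [integral_add (hDi.const_mul A) (hxDi.const_mul B), integral_const_mul, integral_const_mul,
      hD0, hD1]; simp
  have hne : ∀ᵐ z ∂(volume.restrict (Ioi (0:ℝ))), z ≠ y :=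
    ae_restrict_of_ae (Measure.ae_ne volume y)
  have hmem : ∀ᵐ z ∂(volume.restrict (Ioi (0:ℝ))), z ∈ Ioi (0:ℝ) := ae_restrict_mem measurableSet_Ioi
  have hnn : 0 ≤ᵐ[volume.restrict (Ioi (0:ℝ))] fun z => (A + B * z) * D z := by
    filter_upwards [hne, hmem] with z h1 h2
    exact (hpos z h2 h1).le
  have hae := (integral_eq_zero_iff_of_nonneg_ae hnn hI).1 hz
  have : ∀ᵐ z ∂(volume.restrict (Ioi (0:ℝ))), False := by
    filter_upwards [hne, hmem, hae] with z h1 h2 h3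
    exact absurd h3 (hpos z h2 h1).ne'
  rw [ae_iff] at this
  simp at this

lemma alpha_ge {h : ℝ → ℝ} {α : ℝ} (h0 : ∀ u, 0 ≤ h u) (hb : ∀ u, 0 ≤ u → h u ≤ α * exp u)
    (hi : IntegrableOn h (Ioi 0))
    (hxi : IntegrableOn (fun x => x * h x) (Ioi 0)) (hm : ∫ x in Ioi 0, h x = 1 - α)
    (h1 : ∫ x in Ioi 0, x * h x = α) : 1 ≤ α * exp 1 := by
  have hu : Ioi (0:ℝ) = Ioc 0 1 ∪ Ioi 1 := (Ioc_union_Ioi_eq_Ioi zero_le_one).symm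
  have hI : IntegrableOn (fun x => (1 - x) * h x) (Ioi 0) := by
    simp only [sub_mul, one_mul]; exact hi.sub hxi
  have e1 : ∫ x in Ioi 0, (1 - x) * h x = 1 - 2 * α := by
    simp only [sub_mul, one_mul]; rw [integral_sub hi hxi, hm, h1]; ring
  have j1 : IntegrableOn (fun x => (1 - x) * h x) (Ioc 0 1) := hI.mono_set (by rw [hu]; exact subset_union_left)
  have j2 : IntegrableOn (fun x => (1 - x) * h x) (Ioi 1) := hI.mono_set (by rw [hu]; exact subset_union_right)
  rw [hu, setIntegral_union (Ioc_disjoint_Ioi le_rfl) measurableSet_Ioi j1 j2] at e1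
  have k2 : ∫ x in Ioi 1, (1 - x) * h x ≤ 0 :=
    setIntegral_nonpos measurableSet_Ioi fun x hx =>
      mul_nonpos_of_nonpos_of_nonneg (by have : 1 < x := hx; linarith) (h0 x)
  have k1 : ∫ x in Ioc 0 1, (1 - x) * h x ≤ ∫ x in Ioc (0:ℝ) 1, (-α) * ((x - 1) * exp x) := by
    refine setIntegral_mono_on j1 ?_ measurableSet_Ioc ?_
    · exact ((by fun_prop : Continuous fun x : ℝ => (-α) * ((x - 1) * exp x)).integrableOn_Icc).mono_set
        Ioc_subset_Icc_self
    · intro x hx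
      have := hb x hx.1.le
      nlinarith [hx.2]
  rw [integral_const_mul, ← intervalIntegral.integral_of_le (f := fun x => (x - 1) * exp x) zero_le_one,
    intervalIntegral.integral_eq_sub_of_hasDerivAt (fun x _ => hasDerivAt_lin_exp 1 x)
        ((by fun_prop : Continuous fun x : ℝ => (x - 1) * exp x).intervalIntegrable _ _)] at k1
  simp at k1
  nlinarith

lemma left_le {h : ℝ → ℝ} (hf : IsLogConcaveFn h) {α s : ℝ} (hs0 : 0 ≤ s) (hs1 : s ≤ 1)
    (hw : 2 * α * ww s = 1) (hb : ∀ u, 0 ≤ u → h u ≤ α * exp u)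
    (hi : IntegrableOn h (Ioi 0))
    (hxi : IntegrableOn (fun x => x * h x) (Ioi 0)) (hm : ∫ x in Ioi 0, h x = 1 - α)
    (h1 : ∫ x in Ioi 0, x * h x = α) {t : ℝ} (ht : 0 ≤ t) :
    ∫ x in Ioi 0, max (x - t) 0 * h x ≤ α * (2 * SS s t) := by
  obtain ⟨a1, a2⟩ := gam_int hs0 hs1
  obtain ⟨b1, b2⟩ := gam_int1 hs0 hs1 (le_refl (0:ℝ))
  simp only [sub_zero] at b1 b2
  have e : ∀ x, x * (α * gam s x) = α * (x * gam s x) := fun x => by ring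
  have hSS0 : SS s 0 = 1 / 2 := by simp [SS, hs0]
  have := cmp_le hi hxi (g := fun x => α * gam s x) (a1.const_mul α)
    (by simp only [e]; exact b1.const_mul α)
    (by rw [integral_const_mul, a2, hm]; linarith)
    (by simp only [e]; rw [integral_const_mul, b2, h1, hSS0]; ring) ?_ t
  · refine this.trans_eq ?_
    have e : ∀ x, max (x - t) 0 * (α * gam s x) = α * (max (x - t) 0 * gam s x) := fun x => by ring
    simp only [e]
    rw [integral_const_mul, integral_max ht, (gam_int1 hs0 hs1 ht).2]
  · have key : {x : ℝ | 0 < x ∧ α * gam s x < h x}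
        = Ioi s ∩ {x | α * exp s * qq (1 - s) (x - s) < h x} := by
      ext x
      simp only [mem_ofPred_eq, mem_inter_iff, mem_Ioi]
      constructor
      · rintro ⟨p1, p2⟩
        have : s < x := by
          by_contra hcon
          have h2 := hb x p1.le
          simp only [gam, not_lt.1 hcon, if_true] at p2
          linarith
        refine ⟨this, ?_⟩
        simp only [gam, not_le.2 this, if_false] at p2
        linarith
      · rintro ⟨p1, p2⟩
        refine ⟨by linarith, ?_⟩
        simp only [gam, not_le.2 p1, if_false]
        linarith
    rw [key]
    refine ordConnected_Ioi.inter ?_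
    by_cases hτ : 1 - s ≤ 0
    · simp only [qq, hτ, if_true, mul_zero]
      exact hf.ordConnected 0
    · simp only [qq, hτ, if_false]
      have := hf.ordConnected_exp (α * exp s * exp (s / (1 - s))) (1 / (1 - s))
      convert this using 4 with x
      rw [mul_assoc (α * exp s), ← exp_add]
      congr 2
      ring

lemma ww_surj {v : ℝ} (h1 : 1 ≤ v) (h2 : v ≤ exp 1 / 2) : ∃ s ∈ Icc (0:ℝ) 1, ww s = v := by
  have hc : ContinuousOn ww (Icc 0 1) := by unfold ww; fun_prop
  have := intermediate_value_Icc zero_le_one hc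
  have hv : v ∈ Icc (ww 0) (ww 1) := by
    constructor
    · simpa [ww] using h1
    · refine h2.trans_eq ?_
      unfold ww; ring
  exact this hv

theorem coreA {f : ℝ → ℝ} (hf : IsLogConcaveFn f) {α : ℝ} (hα : 0 < α) (hα2 : α ≤ 1 / 2)
    (hi : IntegrableOn f (Ioi 0)) (hxi : IntegrableOn (fun x => x * f x) (Ioi 0))
    (h0 : ∫ x in Ioi 0, f x = α) (h1 : ∫ x in Ioi 0, x * f x = α)
    (gi : IntegrableOn (fun x => f (-x)) (Ioi 0)) (gxi : IntegrableOn (fun x => x * f (-x)) (Ioi 0))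
    (g0 : ∫ x in Ioi 0, f (-x) = 1 - α) (g1 : ∫ x in Ioi 0, x * f (-x) = α) :
    ∃ s ∈ Icc (0:ℝ) 1, 2 * α * ww s = 1 ∧ ∀ t, 0 ≤ t →
      (∫ x in Ioi 0, max (x - t) 0 * f x) + ∫ x in Ioi 0, max (x - t) 0 * f (-x)
        ≤ 2 * α * (exp (-t) / 2 + SS s t) := by
  have hb : ∀ u, 0 ≤ u → f (-u) ≤ α * exp u := fun u hu => by
    simpa using left_bound hf hα hi hxi h0 h1 (x := -u) (by linarith)
  have hα1 := alpha_ge (fun u => hf.1 (-u)) hb gi gxi g0 g1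
  obtain ⟨s, hs, hws⟩ := ww_surj (v := 1 / (2 * α)) (by rw [le_div_iff₀ (by positivity)]; linarith)
    (by rw [div_le_iff₀ (by positivity)]; linarith)
  have hw : 2 * α * ww s = 1 := by rw [hws]; field_simp
  refine ⟨s, hs, hw, fun t ht => ?_⟩
  have hf' : IsLogConcaveFn (fun x => f (-x)) := by simpa using hf.comp_mul (-1)
  have r := right_le hf hi hxi h0 h1 ht
  have l := left_le hf' hs.1 hs.2 hw hb gi gxi g0 g1 ht
  linarith

/-! ### Elementary bounds for the exponential function -/

lemma exp_le_cubic {y : ℝ} (h0 : 0 ≤ y) (h1 : y ≤ 1) :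
    exp y ≤ 1 + y + y ^ 2 / 2 + 11 / 50 * y ^ 3 := by
  have := Real.exp_bound' h0 h1 (n := 5) (by norm_num)
  simp [Finset.sum_range_succ, Nat.factorial] at this
  have e : y ^ 3 * (1 - y) ≥ 0 := by have := sub_nonneg.2 h1; positivity
  have e2 : y ^ 3 * (1 - y ^ 2) ≥ 0 := by
    have : 0 ≤ 1 - y ^ 2 := by nlinarith
    positivity
  nlinarith

lemma exp_le_quartic {y : ℝ} (h0 : 0 ≤ y) (h1 : y ≤ 1) :
    exp y ≤ 1 + y + y ^ 2 / 2 + y ^ 3 / 6 + y ^ 4 / 16 := by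
  have := Real.exp_bound' h0 h1 (n := 5) (by norm_num)
  simp [Finset.sum_range_succ, Nat.factorial] at this
  have e : y ^ 4 * (1 - y) ≥ 0 := by have := sub_nonneg.2 h1; positivity
  nlinarith [pow_nonneg h0 4]

lemma exp_ge_quartic {y : ℝ} (h0 : 0 ≤ y) :
    1 + y + y ^ 2 / 2 + y ^ 3 / 6 + y ^ 4 / 24 ≤ exp y := by
  have := Real.sum_le_exp_of_nonneg h0 5
  simp [Finset.sum_range_succ, Nat.factorial] at this
  linarith

lemma exp_neg_le_quartic {y : ℝ} (h0 : 0 ≤ y) :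
    exp (-y) ≤ 1 - y + y ^ 2 / 2 - y ^ 3 / 6 + y ^ 4 / 24 := by
  have h := exp_ge_quartic h0
  have hp : 0 < 1 - y + y ^ 2 / 2 - y ^ 3 / 6 + y ^ 4 / 24 := by
    nlinarith [sq_nonneg (y ^ 2 - 2 * y), sq_nonneg (y - 1), sq_nonneg (y-2)]
  have key : 1 ≤ (1 - y + y ^ 2 / 2 - y ^ 3 / 6 + y ^ 4 / 24) *
      (1 + y + y ^ 2 / 2 + y ^ 3 / 6 + y ^ 4 / 24) := by
    nlinarith [pow_nonneg h0 6, pow_nonneg h0 8]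
  rw [exp_neg, inv_le_iff_one_le_mul₀ (exp_pos y)]
  exact key.trans (mul_le_mul_of_nonneg_left h hp.le)

lemma exp_neg_ge_cubic {y : ℝ} (h0 : 0 ≤ y) (h1 : y ≤ 1) :
    1 - y + y ^ 2 / 2 - y ^ 3 / 6 ≤ exp (-y) := by
  have h := exp_le_quartic h0 h1
  have hp : 0 ≤ 1 - y + y ^ 2 / 2 - y ^ 3 / 6 := by
    nlinarith [pow_le_one₀ h0 h1 (n := 3), sq_nonneg (y - 1), mul_nonneg h0 (sub_nonneg.2 h1)]
  have key : (1 - y + y ^ 2 / 2 - y ^ 3 / 6) *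
      (1 + y + y ^ 2 / 2 + y ^ 3 / 6 + y ^ 4 / 16) ≤ 1 := by
    have e1 : (1 - y + y ^ 2 / 2 - y ^ 3 / 6) ≤ 1 := by nlinarith [pow_nonneg h0 3]
    have e2 := mul_le_mul_of_nonneg_right e1 (pow_nonneg h0 4)
    nlinarith [pow_nonneg h0 6, pow_nonneg h0 4]
  rw [exp_neg, ← one_div, le_div_iff₀ (exp_pos y)]
  exact (mul_le_mul_of_nonneg_left h hp).trans key

/-- The scalar inequality behind the comparison with the exponential profile. -/
lemma scalar_main {y : ℝ} (h0 : 0 ≤ y) (h1 : y ≤ 1) :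
    exp (-y) / 2 + exp y * (1 - y) ^ 2 / 2 ≤ exp (-(ww y * y)) := by
  set U := 1 + y + y ^ 2 / 2 + 11 / 50 * y ^ 3 with hU
  have hy1 : 0 ≤ 1 - y := sub_nonneg.2 h1
  have eU := exp_le_cubic h0 h1
  have em := exp_neg_le_quartic h0
  set b := y * (2 - y) * U / 4 with hb
  have hU3 : U ≤ 3 := by
    rw [hU]; nlinarith [pow_le_one₀ h0 h1 (n := 3), pow_le_one₀ h0 h1 (n := 2)]
  have hU0 : 0 ≤ U := by rw [hU]; positivity
  have hb0 : 0 ≤ b := by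
    rw [hb]; have : 0 ≤ 2 - y := by linarith
    positivity
  have hb1 : b ≤ 1 := by
    have : y * (2 - y) ≤ 1 := by nlinarith [sq_nonneg (1 - y)]
    have := mul_le_mul this hU3 hU0 zero_le_one
    rw [hb]; linarith
  have hL := exp_neg_ge_cubic hb0 hb1
  have hTL : 1 - y / 2 - y ^ 2 / 8 + y ^ 3 / 10 ≤ 1 - b + b ^ 2 / 2 - b ^ 3 / 6 := by
    have : 1 - b + b ^ 2 / 2 - b ^ 3 / 6 - (1 - y / 2 - y ^ 2 / 8 + y ^ 3 / 10) = y ^ 3 * (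
      1/240 * (y^0 * (1-y)^12) + 13/200 * (y^1 * (1-y)^11) + 151/320 * (y^2 * (1-y)^10)
       + 6491/3200 * (y^3 * (1-y)^9) + 18173/3200 * (y^4 * (1-y)^8)
       + 1742593/160000 * (y^5 * (1-y)^7) + 2352349/160000 * (y^6 * (1-y)^6)
       + 180809/12800 * (y^7 * (1-y)^5) + 3081457/320000 * (y^8 * (1-y)^4)
       + 219246077/48000000 * (y^9 * (1-y)^3) + 360209/250000 * (y^10 * (1-y)^2)
       + 68367/250000 * (y^11 * (1-y)^1) + 8923/375000 * (y^12 * (1-y)^0)) := by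
      rw [hb, hU]; ring
    have h2 : 0 ≤ 1 - b + b ^ 2 / 2 - b ^ 3 / 6 - (1 - y / 2 - y ^ 2 / 8 + y ^ 3 / 10) := by
      rw [this]; positivity
    linarith
  have hLL : exp (-y) / 2 + exp y * (1 - y) ^ 2 / 2 ≤ (1 - y / 2 - y ^ 2 / 8 + y ^ 3 / 10) ^ 2 := by
    have : (1 - y / 2 - y ^ 2 / 8 + y ^ 3 / 10) ^ 2
        - ((1 - y + y ^ 2 / 2 - y ^ 3 / 6 + y ^ 4 / 24) / 2 + U * (1 - y) ^ 2 / 2) = y ^ 3 * (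
      179/600 * (y^0 * (1-y)^3) + 3647/4800 * (y^1 * (1-y)^2) + 47/96 * (y^2 * (1-y)^1)
       + 61/1600 * (y^3 * (1-y)^0)) := by
      rw [hU]; ring
    have h2 : 0 ≤ (1 - y / 2 - y ^ 2 / 8 + y ^ 3 / 10) ^ 2
        - ((1 - y + y ^ 2 / 2 - y ^ 3 / 6 + y ^ 4 / 24) / 2 + U * (1 - y) ^ 2 / 2) := by
      rw [this]; positivity
    have h3 := mul_le_mul_of_nonneg_right eU (sq_nonneg (1 - y))
    linarith
  have hL0 : 0 ≤ 1 - y / 2 - y ^ 2 / 8 + y ^ 3 / 10 := by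
    nlinarith [pow_nonneg h0 3]
  refine hLL.trans ?_
  calc (1 - y / 2 - y ^ 2 / 8 + y ^ 3 / 10) ^ 2 ≤ exp (-b) ^ 2 :=
        pow_le_pow_left₀ hL0 (hTL.trans hL) 2
    _ = exp (-(2 * b)) := by rw [← exp_nat_mul]; congr 1; push_cast; ring
    _ ≤ exp (-(ww y * y)) := by
        apply exp_le_exp.2
        have := mul_le_mul_of_nonneg_left eU (show 0 ≤ y * (2 - y) by nlinarith)
        rw [← hU] at this; unfold ww; rw [hb]; linarith

lemma rho_bound {τ : ℝ} (h0 : 0 ≤ τ) (h1 : τ ≤ 1) : exp τ / (1 + τ) ≤ 1 + τ ^ 2 / 2 := by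
  rw [div_le_iff₀ (by linarith)]
  have := exp_le_cubic h0 h1
  nlinarith [pow_nonneg h0 3]

lemma scalar_end {τ ρ : ℝ} (h0 : 0 < τ) (h1 : τ ≤ 1) (hρ : ρ ≤ 1 + τ ^ 2 / 2) :
    1 ≤ exp (1 - ρ) + τ ^ 2 * exp (1 - τ - (ρ - 1) / τ) := by
  have e1 := add_one_le_exp (1 - ρ)
  have e2 : (ρ - 1) / τ ≤ τ / 2 := by rw [div_le_iff₀ h0]; nlinarith
  have e3 := add_one_le_exp (1 - τ - (ρ - 1) / τ)
  have e4 : 1 / 2 ≤ exp (1 - τ - (ρ - 1) / τ) := by linarith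
  nlinarith [sq_nonneg τ]

/-! ### Moments of functions with a single sign change -/

lemma upset_moment {Δ : ℝ → ℝ} {r r' : ℝ} (hr : r ≤ r')
    (hup : ∀ x y, 0 < x → x < y → 0 < Δ x → 0 ≤ Δ y)
    (I1 : IntegrableOn (fun t => t ^ r * Δ t) (Ioi 0))
    (I2 : IntegrableOn (fun t => t ^ r' * Δ t) (Ioi 0)) :
    (0 ≤ ∫ t in Ioi 0, t ^ r * Δ t → 0 ≤ ∫ t in Ioi 0, t ^ r' * Δ t) ∧
    (∫ t in Ioi 0, t ^ r' * Δ t ≤ 0 → ∫ t in Ioi 0, t ^ r * Δ t ≤ 0) := by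
  have hmem : ∀ᵐ z ∂(volume.restrict (Ioi (0:ℝ))), z ∈ Ioi (0:ℝ) := ae_restrict_mem measurableSet_Ioi
  -- transfer of a.e. vanishing between the two exponents
  have tr : ∀ a b : ℝ, (∀ᵐ z ∂(volume.restrict (Ioi (0:ℝ))), z ^ a * Δ z = 0) →
      ∫ t in Ioi 0, t ^ b * Δ t = 0 := by
    intro a b h
    apply integral_eq_zero_of_ae
    filter_upwards [h, hmem] with z h1 h2
    rcases mul_eq_zero.1 h1 with h3 | h3
    · exact absurd h3 (rpow_pos_of_pos h2 a).ne'
    · simp [h3]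
  by_cases hpos : ∀ x, 0 < x → 0 ≤ Δ x
  · refine ⟨fun _ => setIntegral_nonneg measurableSet_Ioi fun x hx =>
      mul_nonneg (rpow_pos_of_pos hx _).le (hpos x hx), fun h => ?_⟩
    have hnn : 0 ≤ᵐ[volume.restrict (Ioi (0:ℝ))] fun t => t ^ r' * Δ t := by
      filter_upwards [hmem] with x hx
      exact mul_nonneg (rpow_pos_of_pos hx _).le (hpos x hx)
    have h0 := le_antisymm h (integral_nonneg_of_ae hnn)
    exact (tr r' r ((integral_eq_zero_iff_of_nonneg_ae hnn I2).1 h0)).le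
  by_cases hneg : ∀ x, 0 < x → Δ x ≤ 0
  · refine ⟨fun h => ?_, fun _ => setIntegral_nonpos measurableSet_Ioi fun x hx =>
      mul_nonpos_of_nonneg_of_nonpos (rpow_pos_of_pos hx _).le (hneg x hx)⟩
    have hnn : 0 ≤ᵐ[volume.restrict (Ioi (0:ℝ))] fun t => -(t ^ r * Δ t) := by
      filter_upwards [hmem] with x hx
      exact neg_nonneg.2 (mul_nonpos_of_nonneg_of_nonpos (rpow_pos_of_pos hx _).le (hneg x hx))
    have h1 := integral_nonneg_of_ae hnn
    have h0 : ∫ t in Ioi 0, -(t ^ r * Δ t) = 0 := by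
      rw [integral_neg] at h1 ⊢
      linarith
    have h2 := (integral_eq_zero_iff_of_nonneg_ae hnn I1.neg).1 h0
    refine (tr r r' ?_).ge
    filter_upwards [h2] with z hz
    simpa using hz
  push Not at hpos hneg
  obtain ⟨x0, hx0, hx0'⟩ := hpos
  obtain ⟨x1, hx1, hx1'⟩ := hneg
  set E := {x : ℝ | 0 < x ∧ 0 < Δ x} with hE
  have hEb : ∀ x ∈ E, x0 ≤ x := by
    intro x hx
    by_contra hc
    have := hup x x0 hx.1 (not_le.1 hc) hx.2
    linarith
  have hne : E.Nonempty := ⟨x1, hx1, hx1'⟩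
  have hbd : BddBelow E := ⟨x0, hEb⟩
  set a := sInf E with ha
  have ha0 : 0 < a := lt_of_lt_of_le hx0 (le_csInf hne hEb)
  have hc0 : 0 < a ^ (r' - r) := rpow_pos_of_pos ha0 _
  have pt : ∀ x ∈ Ioi (0:ℝ), a ^ (r' - r) * (x ^ r * Δ x) ≤ x ^ r' * Δ x := by
    intro x hx
    have hx : 0 < x := hx
    have e : x ^ r' = x ^ (r' - r) * x ^ r := by rw [← rpow_add hx]; congr 1; ring
    have hp := rpow_pos_of_pos hx r
    have : 0 ≤ (x ^ (r' - r) - a ^ (r' - r)) * Δ x := by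
      rcases lt_trichotomy x a with h | h | h
      · have h1 : Δ x ≤ 0 := by
          by_contra hc
          exact absurd (csInf_le hbd (show x ∈ E from ⟨hx, not_le.1 hc⟩)) (not_le.2 h)
        have h2 : x ^ (r' - r) ≤ a ^ (r' - r) := rpow_le_rpow hx.le h.le (by linarith)
        exact mul_nonneg_of_nonpos_of_nonpos (by linarith) h1
      · rw [h]; simp
      · obtain ⟨e, he, hex⟩ := exists_lt_of_csInf_lt hne h
        have h1 := hup e x he.1 hex he.2
        have h2 : a ^ (r' - r) ≤ x ^ (r' - r) := rpow_le_rpow ha0.le h.le (by linarith)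
        exact mul_nonneg (by linarith) h1
    rw [e]
    nlinarith
  have main := setIntegral_mono_on (I1.const_mul (a ^ (r' - r))) I2 measurableSet_Ioi pt
  rw [integral_const_mul] at main
  constructor
  · intro h
    exact (mul_nonneg hc0.le h).trans main
  · intro h
    by_contra hc
    have := mul_pos hc0 (not_le.1 hc)
    linarith

lemma mvt_trick {D D' D'' : ℝ → ℝ} {a b : ℝ} (h1 : ∀ x, HasDerivAt D (D' x) x)
    (h2 : ∀ x, HasDerivAt D' (D'' x) x) (anti : ∀ x y, a ≤ x → x ≤ y → D'' y ≤ D'' x)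
    (ha : 0 ≤ D a) (ha' : 0 ≤ D' a) (hb : 0 ≤ D b) {x : ℝ} (hax : a ≤ x) (hxb : x ≤ b) :
    0 ≤ D x := by
  by_contra hc
  rw [not_le] at hc
  have hax' : a < x := lt_of_le_of_ne hax (by rintro rfl; linarith)
  have hxb' : x < b := lt_of_le_of_ne hxb (by rintro rfl; linarith)
  have cD : Continuous D := continuous_iff_continuousAt.2 fun x => (h1 x).continuousAt
  have cD' : Continuous D' := continuous_iff_continuousAt.2 fun x => (h2 x).continuousAt
  obtain ⟨u, hu, eu⟩ := exists_hasDerivAt_eq_slope D D' hax' cD.continuousOn (fun x _ => h1 x)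
  obtain ⟨v, hv, ev⟩ := exists_hasDerivAt_eq_slope D D' hxb' cD.continuousOn (fun x _ => h1 x)
  have hu' : D' u < 0 := by rw [eu]; exact div_neg_of_neg_of_pos (by linarith) (by linarith)
  have hv' : 0 < D' v := by rw [ev]; exact div_pos (by linarith) (by linarith)
  obtain ⟨k, hk, ek⟩ := exists_hasDerivAt_eq_slope D' D'' hu.1 cD'.continuousOn (fun x _ => h2 x)
  obtain ⟨l, hl, el⟩ := exists_hasDerivAt_eq_slope D' D'' (hu.2.trans hv.1) cD'.continuousOn (fun x _ => h2 x)
  have hk' : D'' k < 0 := by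
    rw [ek]; exact div_neg_of_neg_of_pos (by linarith) (by linarith [hu.1])
  have hl' : 0 < D'' l := by rw [el]; exact div_pos (by linarith) (by linarith [hu.2, hv.1])
  have := anti k l hk.1.le (hk.2.trans hl.1).le
  linarith

/-! ### The profiles -/

noncomputable def PP (s t : ℝ) : ℝ := exp (-(t / ww s)) / 2 + SS s (t / ww s)

lemma ww_pos {s : ℝ} (h : s ≤ 1) : 0 < ww s := by
  unfold ww; have : 0 < 2 - s := by linarith
  positivity

lemma ww_mono {s t : ℝ} (hst : s ≤ t) (ht : t ≤ 1) : ww s ≤ ww t := by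
  have hd : ∀ x : ℝ, HasDerivAt ww ((1 - x) * exp x / 2) x := by
    intro x
    have h1 : HasDerivAt (fun x : ℝ => 2 - x) (-1) x := by
      simpa using (hasDerivAt_id x).const_sub 2
    refine ((h1.mul (Real.hasDerivAt_exp x)).div_const 2).congr_deriv ?_
    ring
  have : MonotoneOn ww (Iic 1) := by
    refine monotoneOn_of_deriv_nonneg (convex_Iic 1)
      (fun x _ => (hd x).continuousAt.continuousWithinAt) (fun x _ => (hd x).differentiableAt.differentiableWithinAt) ?_
    intro x hx
    rw [interior_Iic] at hx
    rw [(hd x).deriv]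
    have : x < 1 := hx
    have : 0 ≤ 1 - x := by linarith
    positivity
  exact this (hst.trans ht) ht hst

lemma ww_one : ww 1 = exp 1 / 2 := by unfold ww; ring

lemma ww_zero : ww 0 = 1 := by simp [ww]

lemma one_le_ww {s : ℝ} (h0 : 0 ≤ s) (h1 : s ≤ 1) : 1 ≤ ww s := by
  rw [← ww_zero]; exact ww_mono h0 h1

lemma gam_nonneg (s x : ℝ) : 0 ≤ gam s x := by
  unfold gam; split_ifs
  · exact (exp_pos _).le
  · exact mul_nonneg (exp_pos _).le (qq_nonneg _ _)

lemma SS_nonneg {s : ℝ} (h0 : 0 ≤ s) (h1 : s ≤ 1) {t : ℝ} (ht : 0 ≤ t) : 0 ≤ SS s t := by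
  have := (gam_int1 h0 h1 ht).2
  have h : 0 ≤ ∫ x in Ioi t, (x - t) * gam s x :=
    setIntegral_nonneg measurableSet_Ioi fun x hx =>
      mul_nonneg (by have : t < x := hx; linarith) (gam_nonneg s x)
  linarith

lemma SS_measurable (s : ℝ) : Measurable (SS s) := by
  unfold SS
  refine Measurable.ite measurableSet_Iic (by fun_prop) ?_
  unfold qq
  by_cases h : 1 - s ≤ 0
  · simp [h]
  · simp only [h, if_false]; fun_prop

lemma SS_le {s : ℝ} (h0 : 0 ≤ s) (h1 : s ≤ 1) {y : ℝ} (hy : 0 ≤ y) :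
    SS s y ≤ exp 2 * exp (-y) := by
  rw [← exp_add]
  unfold SS
  split_ifs with h
  · have : 0 ≤ ww s * y := mul_nonneg (ww_pos h1).le hy
    have h2 : exp y ≤ exp (2 + -y) := exp_le_exp.2 (by linarith)
    have := exp_pos y
    linarith
  · rw [not_le] at h
    have hq : qq (1 - s) (y - s) ≤ exp (-(y - s)) := by
      unfold qq
      split_ifs with h3
      · exact (exp_pos _).le
      · apply exp_le_exp.2
        rw [div_le_iff₀ (not_le.1 h3)]
        nlinarith
    have h4 : exp s * (1 - s) ^ 2 / 2 ≤ exp s := by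
      have : (1 - s) ^ 2 ≤ 1 := by nlinarith
      nlinarith [exp_pos s]
    calc _ ≤ exp s * exp (-(y - s)) := mul_le_mul h4 hq (qq_nonneg _ _) (exp_pos _).le
      _ = exp (s + -(y - s)) := (exp_add _ _).symm
      _ ≤ _ := exp_le_exp.2 (by linarith)

lemma SS_rpow_integrable {s : ℝ} (h0 : 0 ≤ s) (h1 : s ≤ 1) {r : ℝ} (hr : -1 < r) :
    IntegrableOn (fun y => y ^ r * SS s y) (Ioi 0) := by
  have h := integrableOn_rpow_mul_exp_neg_mul_rpow (p := 1) (s := r) (b := 1) hr one_pos one_pos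
  simp only [rpow_one, neg_mul, one_mul] at h
  refine Integrable.mono' (h.const_mul (exp 2)) ?_ ?_
  · exact ((measurable_id.pow_const r).mul (SS_measurable s)).aestronglyMeasurable
  · filter_upwards [ae_restrict_mem measurableSet_Ioi] with y hy
    have hy : 0 < y := hy
    rw [Real.norm_of_nonneg (mul_nonneg (rpow_pos_of_pos hy r).le (SS_nonneg h0 h1 hy.le))]
    have := mul_le_mul_of_nonneg_left (SS_le h0 h1 hy.le) (rpow_pos_of_pos hy r).le
    linarith

lemma exp_rpow_integrable {r : ℝ} (hr : -1 < r) :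
    IntegrableOn (fun y : ℝ => y ^ r * exp (-y)) (Ioi 0) := by
  have h := integrableOn_rpow_mul_exp_neg_mul_rpow (p := 1) (s := r) (b := 1) hr one_pos one_pos
  simpa only [rpow_one, neg_mul, one_mul] using h

lemma QQ_integrable {s : ℝ} (h0 : 0 ≤ s) (h1 : s ≤ 1) {r : ℝ} (hr : -1 < r) :
    IntegrableOn (fun y => y ^ r * (exp (-y) / 2 + SS s y)) (Ioi 0) := by
  refine (((exp_rpow_integrable hr).const_mul (1/2)).add (SS_rpow_integrable h0 h1 hr)).congr ?_
  filter_upwards with y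
  simp only [Pi.add_apply]; ring

/-- Scaling: the integral of `t^r π_s(t)`. -/
lemma PP_scale {s : ℝ} (h0 : 0 ≤ s) (h1 : s ≤ 1) {r : ℝ} (hr : -1 < r) :
    IntegrableOn (fun t => t ^ r * PP s t) (Ioi 0) ∧
    ∫ t in Ioi 0, t ^ r * PP s t = ww s ^ (r + 1) * ∫ y in Ioi 0, y ^ r * (exp (-y) / 2 + SS s y) := by
  have hw := ww_pos h1
  have e : ∀ t ∈ Ioi (0:ℝ), ww s ^ r * ((t * (ww s)⁻¹) ^ r * (exp (-(t * (ww s)⁻¹)) / 2 + SS s (t * (ww s)⁻¹)))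
      = t ^ r * PP s t := by
    intro t ht
    have ht : 0 < t := ht
    rw [mul_rpow ht.le (inv_nonneg.2 hw.le), inv_rpow hw.le]
    have : ww s ^ r ≠ 0 := (rpow_pos_of_pos hw r).ne'
    unfold PP
    rw [← div_eq_mul_inv]
    field_simp
  constructor
  · have i1 := (integrableOn_Ioi_comp_mul_right_iff (fun y => y ^ r * (exp (-y) / 2 + SS s y)) 0 (inv_pos.2 hw)).2
      (by rw [zero_mul]; exact QQ_integrable h0 h1 hr)
    exact IntegrableOn.congr_fun (MeasureTheory.Integrable.const_mul i1 (ww s ^ r) : IntegrableOn _ (Ioi _) volume)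
      e measurableSet_Ioi
  · rw [← setIntegral_congr_fun measurableSet_Ioi e, integral_const_mul,
      integral_comp_mul_right_Ioi (fun y => y ^ r * (exp (-y) / 2 + SS s y)) 0 (inv_pos.2 hw),
      zero_mul, inv_inv, rpow_add hw, rpow_one, smul_eq_mul]
    ring

/-! ### Sign changes between profiles -/

lemma exp_add_self_mono {u v : ℝ} (hu : 0 ≤ u) (huv : u ≤ v) : exp (-u) + u ≤ exp (-v) + v := by
  have h := add_one_le_exp (-(v - u))
  have e : exp (-v) = exp (-u) * exp (-(v - u)) := by rw [← exp_add]; congr 1; ring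
  have h1 : exp (-u) ≤ 1 := exp_le_one_iff.2 (by linarith)
  have := exp_pos (-u)
  rw [e]
  nlinarith

lemma PP_small {s t : ℝ} (h1 : s ≤ 1) (hts : t / ww s ≤ s) :
    PP s t = exp (-(t / ww s)) / 2 + exp (t / ww s) / 2 - t := by
  have hw := ww_pos h1
  simp only [PP, SS, hts, if_true]
  field_simp
  ring

lemma PP_le_exp {s t : ℝ} (h1 : s ≤ 1) (ht : 0 ≤ t) (hts : t / ww s ≤ s) : PP s t ≤ exp (-t) := by
  have hw := ww_pos h1
  rw [PP_small h1 hts]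
  set y := t / ww s with hy
  have hy0 : 0 ≤ y := by positivity
  have ht' : t = ww s * y := by rw [hy]; field_simp
  have hm : ww y * y ≤ t := by
    rw [ht']; exact mul_le_mul_of_nonneg_right (ww_mono hts h1) hy0
  have k1 := scalar_main hy0 (hts.trans h1)
  have k2 := exp_add_self_mono (mul_nonneg (ww_pos (hts.trans h1)).le hy0) hm
  have : exp y * (1 - y) ^ 2 / 2 = exp y / 2 - ww y * y := by unfold ww; ring
  linarith

/-- Formula for the profile beyond the breakpoint (including it). -/
lemma PP_large {s t : ℝ} (h1 : s ≤ 1) (hts : s ≤ t / ww s) :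
    PP s t = exp (-(t / ww s)) / 2 + exp s * (1 - s) ^ 2 / 2 * qq (1 - s) (t / ww s - s) := by
  rcases hts.eq_or_lt with h | h
  · simp only [PP, SS, ← h, le_refl, if_true, sub_self]
    have := tau_qq_zero (τ := 1 - s) (by linarith)
    have e : exp s * (1 - s) ^ 2 / 2 * qq (1 - s) 0 = exp s * (1 - s) / 2 * ((1 - s) * qq (1 - s) 0) := by ring
    rw [e, this]
    unfold ww; ring
  · simp only [PP, SS, not_le.2 h, if_false]

lemma convex_two_exp {A B : ℝ} (hA : 0 ≤ A) (hB : 0 ≤ B) (k l : ℝ) :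
    ConvexOn ℝ univ (fun t => A * exp (k * t) + B * exp (l * t)) := by
  have h (m : ℝ) : ConvexOn ℝ univ (fun t => exp (m * t)) := by
    have := convexOn_exp.comp_linearMap (LinearMap.mulLeft ℝ m)
    exact this
  exact ((h k).smul hA).add ((h l).smul hB)

lemma qq_form (τ s w : ℝ) : ∃ B l : ℝ, 0 ≤ B ∧ ∀ t, qq τ (t / w - s) = B * exp (l * t) := by
  by_cases h : τ ≤ 0
  · exact ⟨0, 0, le_rfl, fun t => by simp [qq, h]⟩
  · refine ⟨exp (s / τ), -(1 / (w * τ)), (exp_pos _).le, fun t => ?_⟩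
    simp only [qq, h, if_false]
    rw [← exp_add]; congr 1
    have := (not_le.1 h).ne'
    by_cases hw : w = 0
    · simp [hw]
    field_simp
    ring

/-- `π_s - exp(-t)` changes sign at most once, from minus to plus. -/
lemma cross_two {s : ℝ} (h0 : 0 ≤ s) (h1 : s ≤ 1) {x y : ℝ} (hx : 0 < x) (hxy : x < y)
    (h : 0 < PP s x - exp (-x)) : 0 ≤ PP s y - exp (-y) := by
  have hw := ww_pos h1
  have hxs : s < x / ww s := by
    by_contra hc
    have := PP_le_exp h1 hx.le (not_lt.1 hc)
    linarith
  rw [lt_div_iff₀ hw] at hxs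
  set a := s * ww s with ha
  have ha0 : 0 ≤ a := mul_nonneg h0 hw.le
  have haw : a / ww s = s := by rw [ha]; field_simp
  obtain ⟨B, l, hB, hq⟩ := qq_form (1 - s) s (ww s)
  set K := exp s * (1 - s) ^ 2 / 2 with hK
  have hK0 : 0 ≤ K := by rw [hK]; positivity
  have hform : ∀ t, a ≤ t → exp t * PP s t
      = 1 / 2 * exp ((1 - 1 / ww s) * t) + K * B * exp ((1 + l) * t) := by
    intro t ht
    rw [PP_large h1 (by rw [le_div_iff₀ hw]; exact ht), hq t]
    have e1 : exp ((1 - 1 / ww s) * t) = exp t * exp (-(t / ww s)) := by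
      rw [← exp_add]; congr 1; ring
    have e2 : exp ((1 + l) * t) = exp t * exp (l * t) := by
      rw [← exp_add]; congr 1; ring
    rw [e1, e2]; ring
  have hcv := convex_two_exp (A := 1/2) (B := K * B) (by norm_num) (mul_nonneg hK0 hB)
    (1 - 1 / ww s) (1 + l)
  set g := fun t => 1 / 2 * exp ((1 - 1 / ww s) * t) + K * B * exp ((1 + l) * t) with hg
  have one (t : ℝ) : exp t * exp (-t) = 1 := by rw [← exp_add]; simp
  have ga : g a ≤ 1 := by
    have := PP_le_exp h1 ha0 haw.le
    have h2 := mul_le_mul_of_nonneg_left this (exp_pos a).le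
    rw [one, hform a le_rfl] at h2
    exact h2
  have gx : 1 < g x := by
    have h2 := mul_lt_mul_of_pos_left (sub_pos.1 h) (exp_pos x)
    rw [one, hform x hxs.le] at h2
    exact h2
  have gy : g x ≤ max (g a) (g y) :=
    hcv.le_max_of_mem_Icc (mem_univ _) (mem_univ _) ⟨hxs.le, hxy.le⟩
  have gy' : 1 ≤ g y := by
    rcases le_max_iff.1 gy with h | h <;> linarith
  have hy := hform y (by linarith)
  have : exp y * exp (-y) ≤ exp y * PP s y := by rw [one, hy]; exact gy'
  have := le_of_mul_le_mul_left this (exp_pos y)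
  linarith

lemma cosh_form_mono {u v : ℝ} (hu : 0 ≤ u) (huv : u ≤ v) :
    exp (-u) / 2 + exp u / 2 ≤ exp (-v) / 2 + exp v / 2 := by
  have : cosh u ≤ cosh v := by
    rw [cosh_le_cosh, abs_of_nonneg hu, abs_of_nonneg (hu.trans huv)]; exact huv
  rw [cosh_eq, cosh_eq] at this
  linarith

lemma sinh_form_mono {u v : ℝ} (huv : u ≤ v) :
    exp u / 2 - exp (-u) / 2 ≤ exp v / 2 - exp (-v) / 2 := by
  have h1 := exp_le_exp.2 huv
  have h2 : exp (-v) ≤ exp (-u) := exp_le_exp.2 (by linarith)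
  linarith

lemma hasDerivAt_exp_lin (A k c x : ℝ) :
    HasDerivAt (fun t => A * exp (k * t + c)) (A * k * exp (k * x + c)) x := by
  have h1 : HasDerivAt (fun t : ℝ => k * t + c) k x := by
    simpa using ((hasDerivAt_id x).const_mul k).add_const c
  refine (h1.exp.const_mul A).congr_deriv ?_
  ring

/-- On `[0, w_1]` the profile `π_1` lies below `π_s`. -/
lemma PP_one_le {s : ℝ} (h0 : 0 ≤ s) (h1 : s < 1) {t : ℝ} (ht : 0 ≤ t) (htw : t ≤ ww 1) :
    PP 1 t ≤ PP s t := by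
  have hw := ww_pos h1.le
  have hw1 := ww_pos (le_refl (1:ℝ))
  have hww := ww_mono h1.le le_rfl
  have hinv : 1 / ww 1 ≤ 1 / ww s := one_div_le_one_div_of_le hw hww
  have hP1 : ∀ t, t ≤ ww 1 → PP 1 t = exp (-(t / ww 1)) / 2 + exp (t / ww 1) / 2 - t := fun t h =>
    PP_small le_rfl (by rw [div_le_iff₀ hw1]; linarith)
  have hdiv : ∀ t, 0 ≤ t → t / ww 1 ≤ t / ww s := fun t h => by
    exact div_le_div_of_nonneg_left h hw hww
  rcases le_total (t / ww s) s with hts | hts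
  · rw [hP1 t htw, PP_small h1.le hts]
    have := cosh_form_mono (div_nonneg ht hw1.le) (hdiv t ht)
    linarith
  set a := s * ww s with ha
  have ha0 : 0 ≤ a := mul_nonneg h0 hw.le
  have haw : a / ww s = s := by rw [ha]; field_simp
  have hat : a ≤ t := by rwa [le_div_iff₀ hw] at hts
  have hτ : 0 < 1 - s := by linarith
  set K := exp s * (1 - s) ^ 2 / 2 with hK
  have hK0 : 0 ≤ K := by rw [hK]; positivity
  set w := ww s with hwdef
  set v := ww 1 with hv
  set m := 1 / (w * (1 - s)) with hm
  -- explicit difference and its derivatives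
  set D : ℝ → ℝ := fun t => 1 / 2 * exp (-(1 / w) * t + 0) + K * exp (-m * t + s / (1 - s))
    + (-(1 / 2)) * exp (-(1 / v) * t + 0) + (-(1 / 2)) * exp (1 / v * t + 0) + t with hD
  set D' : ℝ → ℝ := fun t => 1 / 2 * -(1 / w) * exp (-(1 / w) * t + 0) + K * -m * exp (-m * t + s / (1 - s))
    + (-(1 / 2)) * -(1 / v) * exp (-(1 / v) * t + 0) + (-(1 / 2)) * (1 / v) * exp (1 / v * t + 0) + 1 with hD'
  set D'' : ℝ → ℝ := fun t => 1 / 2 * -(1 / w) * -(1 / w) * exp (-(1 / w) * t + 0)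
    + K * -m * -m * exp (-m * t + s / (1 - s))
    + (-(1 / 2)) * -(1 / v) * -(1 / v) * exp (-(1 / v) * t + 0)
    + (-(1 / 2)) * (1 / v) * (1 / v) * exp (1 / v * t + 0) with hD''
  have d1 : ∀ x, HasDerivAt D (D' x) x := fun x =>
    ((((hasDerivAt_exp_lin _ _ _ x).add (hasDerivAt_exp_lin _ _ _ x)).add
      (hasDerivAt_exp_lin _ _ _ x)).add (hasDerivAt_exp_lin _ _ _ x)).add (hasDerivAt_id x)
  have d2 : ∀ x, HasDerivAt D' (D'' x) x := fun x =>
    ((((hasDerivAt_exp_lin _ _ _ x).add (hasDerivAt_exp_lin _ _ _ x)).add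
      (hasDerivAt_exp_lin _ _ _ x)).add (hasDerivAt_exp_lin _ _ _ x)).add_const 1
  have hm0 : 0 < m := by rw [hm]; positivity
  have hvi : 0 < 1 / v := by positivity
  have hwi : 0 < 1 / w := by positivity
  have hDform : ∀ t, a ≤ t → t ≤ v → D t = PP s t - PP 1 t := by
    intro t h2 h3
    rw [hP1 t h3, PP_large h1.le (by rw [← hwdef, le_div_iff₀ hw]; exact h2), ← hwdef]
    have e1 : qq (1 - s) (t / w - s) = exp (-m * t + s / (1 - s)) := by
      simp only [qq, not_le.2 hτ, if_false]
      congr 1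
      rw [hm]; field_simp; ring
    rw [e1, hD]
    have e2 : -(t / w) = -(1 / w) * t + 0 := by ring
    have e3 : -(t / v) = -(1 / v) * t + 0 := by ring
    have e4 : t / v = 1 / v * t + 0 := by ring
    rw [e2, e3, e4]; ring
  have av : a ≤ v := hat.trans htw
  have key : 0 ≤ D t := by
    refine mvt_trick d1 d2 ?_ ?_ ?_ ?_ hat htw
    · intro x y hax hxy
      have c1 : exp (-(1 / w) * y + 0) ≤ exp (-(1 / w) * x + 0) := exp_le_exp.2 (by nlinarith)
      have c2 : exp (-m * y + s / (1 - s)) ≤ exp (-m * x + s / (1 - s)) := exp_le_exp.2 (by nlinarith)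
      have c3 := cosh_form_mono (u := 1 / v * x) (v := 1 / v * y)
        (mul_nonneg hvi.le (ha0.trans hax)) (by nlinarith)
      have b1 := mul_le_mul_of_nonneg_left c1 (by positivity : 0 ≤ 1 / 2 * (1 / w) * (1 / w))
      have b2 := mul_le_mul_of_nonneg_left c2 (by positivity : 0 ≤ K * m * m)
      have b3 := mul_le_mul_of_nonneg_left c3 (by positivity : 0 ≤ (1 / v) * (1 / v))
      simp only [hD'', add_zero] at *
      rw [← neg_mul, ← neg_mul] at b3
      linarith
    · rw [hDform a le_rfl av, hP1 a av, PP_small h1.le haw.le]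
      have := cosh_form_mono (div_nonneg ha0 hw1.le) (hdiv a ha0)
      linarith
    · have e1 : -(1 / w) * a + 0 = -s := by rw [ha]; field_simp; ring
      have e2 : -m * a + s / (1 - s) = 0 := by rw [ha, hm]; field_simp; ring
      have e3 : -(1 / v) * a + 0 = -(a / v) := by ring
      have e4 : 1 / v * a + 0 = a / v := by ring
      simp only [hD', e1, e2, e3, e4, exp_zero, mul_one]
      have f1 := sinh_form_mono (hdiv a ha0)
      rw [haw] at f1
      have f2 : 0 ≤ exp s / 2 - exp (-s) / 2 := by
        have := exp_le_exp.2 (show -s ≤ s by linarith); linarith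
      have f3 : (1 / v) * (exp (a / v) / 2 - exp (-(a / v)) / 2) ≤ (1 / w) * (exp s / 2 - exp (-s) / 2) :=
        (mul_le_mul_of_nonneg_left f1 hvi.le).trans (mul_le_mul_of_nonneg_right hinv f2)
      have f4 : 1 + K * -m = (1 / w) * (exp s / 2) := by
        rw [hK, hm]
        have : w = (2 - s) * exp s / 2 := rfl
        field_simp
        rw [this]; ring
      linarith
    · simp only [hD]
      set ρ := v / w with hρ
      have e1 : -(1 / w) * v + 0 = -ρ := by rw [hρ]; ring
      have e2 : -m * v + s / (1 - s) = -((ρ - s) / (1 - s)) := by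
        rw [hρ, hm]; field_simp; ring
      have e3 : -(1 / v) * v + 0 = -1 := by field_simp; ring
      have e4 : 1 / v * v + 0 = 1 := by field_simp; ring
      rw [e1, e2, e3, e4]
      have hρ' : ρ = exp (1 - s) / (1 + (1 - s)) := by
        have : w = (2 - s) * exp s / 2 := rfl
        rw [hρ, this, hv, ww_one, exp_sub]
        have : 2 - s ≠ 0 := by linarith
        have : 1 + (1 - s) ≠ 0 := by linarith
        field_simp
        ring
      have hb := scalar_end hτ (by linarith) (hρ' ▸ rho_bound hτ.le (by linarith))
      have hv1 : v = exp 1 / 2 := ww_one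
      have g1 : exp (1 - ρ) = exp 1 * exp (-ρ) := by rw [← exp_add]; congr 1
      have g2 : exp (1 - (1 - s) - (ρ - 1) / (1 - s)) = exp 1 * exp s * exp (-((ρ - s) / (1 - s))) := by
        rw [← exp_add, ← exp_add]; congr 1; field_simp; ring
      have g3 : exp 1 * exp (-1) = 1 := by rw [← exp_add]; simp
      rw [g1, g2] at hb
      have : exp 1 * exp (-1) ≤ exp 1 * (exp (-ρ) + 2 * K * exp (-((ρ - s) / (1 - s)))) := by
        rw [g3, hK]; linarith
      have := le_of_mul_le_mul_left this (exp_pos 1)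
      rw [hv1]
      linarith
  rw [hDform t hat htw] at key
  linarith

/-- `π_1 - π_s` changes sign at most once, from minus to plus. -/
lemma cross_one {s : ℝ} (h0 : 0 ≤ s) (h1 : s < 1) {x y : ℝ} (hx : 0 < x) (hxy : x < y)
    (h : 0 < PP 1 x - PP s x) : 0 ≤ PP 1 y - PP s y := by
  have hw := ww_pos h1.le
  have hw1 := ww_pos (le_refl (1:ℝ))
  have hww := ww_mono h1.le le_rfl
  have hinv : 1 / ww 1 ≤ 1 / ww s := one_div_le_one_div_of_le hw hww
  have hτ : 0 < 1 - s := by linarith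
  have hxw : ww 1 < x := by
    by_contra hc
    have := PP_one_le h0 h1 hx.le (not_lt.1 hc)
    linarith
  set K := exp s * (1 - s) ^ 2 / 2 with hK
  have hK0 : 0 ≤ K := by rw [hK]; positivity
  have form : ∀ t, ww 1 ≤ t → exp (t / ww 1) * (PP 1 t - PP s t) = 1 / 2 -
      (1 / 2 * exp (-((1 / ww s - 1 / ww 1) * t)) +
        K * exp (-((1 / (ww s * (1 - s)) - 1 / ww 1) * t) + s / (1 - s))) := by
    intro t ht
    have a1 : (1:ℝ) ≤ t / ww 1 := by rw [le_div_iff₀ hw1]; linarith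
    have a2 : s ≤ t / ww s := by
      rw [le_div_iff₀ hw]; nlinarith
    rw [PP_large le_rfl a1, PP_large h1.le a2]
    have e1 : qq (1 - s) (t / ww s - s) = exp (-(t / ww s - s) / (1 - s)) := by
      simp only [qq, not_le.2 hτ, if_false]
    have e2 : exp (-((1 / ww s - 1 / ww 1) * t)) = exp (t / ww 1) * exp (-(t / ww s)) := by
      rw [← exp_add]; congr 1; ring
    have e3 : exp (-((1 / (ww s * (1 - s)) - 1 / ww 1) * t) + s / (1 - s))
        = exp (t / ww 1) * exp (-(t / ww s - s) / (1 - s)) := by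
      rw [← exp_add]; congr 1; field_simp; ring
    have e4 : exp (t / ww 1) * exp (-(t / ww 1)) = 1 := by rw [← exp_add]; simp
    rw [e1, e2, e3, sub_self]
    linear_combination (1/2) * e4
  have hinv2 : 1 / ww 1 ≤ 1 / (ww s * (1 - s)) := by
    apply one_div_le_one_div_of_le (by positivity)
    nlinarith
  have fx := form x hxw.le
  have fy := form y (by linarith)
  have c1 : exp (-((1 / ww s - 1 / ww 1) * y)) ≤ exp (-((1 / ww s - 1 / ww 1) * x)) :=
    exp_le_exp.2 (by nlinarith)
  have c2 : exp (-((1 / (ww s * (1 - s)) - 1 / ww 1) * y) + s / (1 - s))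
      ≤ exp (-((1 / (ww s * (1 - s)) - 1 / ww 1) * x) + s / (1 - s)) :=
    exp_le_exp.2 (by nlinarith)
  have c3 := mul_le_mul_of_nonneg_left c2 hK0
  have px := mul_pos (exp_pos (x / ww 1)) h
  by_contra hc
  have py := mul_neg_of_pos_of_neg (exp_pos (y / ww 1)) (not_le.1 hc)
  linarith

/-! ### Numerical comparisons of moments -/

lemma K_tail {s : ℝ} (h1 : s ≤ 1) (a b : ℝ) :
    IntegrableOn (fun y => exp s * (1 - s) ^ 2 / 2 * ((a + b * y) * qq (1 - s) (y - s))) (Ioi s) ∧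
    ∫ y in Ioi s, exp s * (1 - s) ^ 2 / 2 * ((a + b * y) * qq (1 - s) (y - s))
      = (a + b) * exp s * (1 - s) ^ 3 / 2 := by
  have hτ : 0 ≤ 1 - s := by linarith
  obtain ⟨i0, e0⟩ := qint0 (c := s) (s := s) hτ
  obtain ⟨i1, e1⟩ := qint (c := s) (d := s) (s := s) hτ le_rfl
  have hz := tau_qq_zero hτ
  have e : ∀ y, (a + b * y) * qq (1 - s) (y - s)
      = (a + b * s) * qq (1 - s) (y - s) + b * ((y - s) * qq (1 - s) (y - s)) := fun y => by ring
  simp only [e]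
  constructor
  · exact ((i0.const_mul _).add (i1.const_mul _)).const_mul _
  · rw [integral_const_mul, integral_add (i0.const_mul _) (i1.const_mul _), integral_const_mul,
      integral_const_mul, e0, e1, sub_self]
    linear_combination (exp s * (1 - s) ^ 2 / 2 * (a + b * s + b * (1 - s))) * hz

lemma SS_lin {s : ℝ} (h0 : 0 ≤ s) (h1 : s ≤ 1) (a b : ℝ) :
    IntegrableOn (fun y => (a + b * y) * SS s y) (Ioi 0) ∧
    ∫ y in Ioi 0, (a + b * y) * SS s y = (a + b * s - b) * exp s / 2 - (a - b) / 2
      - ww s * (a * s ^ 2 / 2 + b * s ^ 3 / 3) + (a + b) * exp s * (1 - s) ^ 3 / 2 := by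
  have hu : Ioi (0:ℝ) = Ioc 0 s ∪ Ioi s := (Ioc_union_Ioi_eq_Ioi h0).symm
  have hc1 : ∀ y ∈ Ioc 0 s, (a + b * y) * (exp y / 2 - ww s * y) = (a + b * y) * SS s y :=
    fun y hy => by simp [SS, hy.2]
  have hc2 : ∀ y ∈ Ioi s, exp s * (1 - s) ^ 2 / 2 * ((a + b * y) * qq (1 - s) (y - s))
      = (a + b * y) * SS s y := fun y hy => by
    simp only [SS, not_le.2 (show s < y from hy), if_false]; ring
  obtain ⟨i2, e2⟩ := K_tail h1 a b
  have hcont : Continuous fun y : ℝ => (a + b * y) * (exp y / 2 - ww s * y) := by fun_prop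
  have j1 : IntegrableOn (fun y => (a + b * y) * SS s y) (Ioc 0 s) :=
    (hcont.integrableOn_Icc.mono_set Ioc_subset_Icc_self).congr_fun hc1 measurableSet_Ioc
  have j2 : IntegrableOn (fun y => (a + b * y) * SS s y) (Ioi s) :=
    i2.congr_fun hc2 measurableSet_Ioi
  refine ⟨by rw [hu]; exact j1.union j2, ?_⟩
  have hder : ∀ y : ℝ, HasDerivAt
      (fun y => (a + b * y - b) * exp y / 2 - ww s * (a * y ^ 2 / 2 + b * y ^ 3 / 3))
      ((a + b * y) * (exp y / 2 - ww s * y)) y := by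
    intro y
    have k1 : HasDerivAt (fun y : ℝ => a + b * y - b) b y := by
      simpa using (((hasDerivAt_id y).const_mul b).const_add a).sub_const b
    have k2 : HasDerivAt (fun y : ℝ => a * y ^ 2 / 2 + b * y ^ 3 / 3) (a * y + b * y ^ 2) y := by
      refine ((((hasDerivAt_pow 2 y).const_mul a).div_const 2).add
        (((hasDerivAt_pow 3 y).const_mul b).div_const 3)).congr_deriv ?_
      norm_num; ring
    refine (((k1.mul (Real.hasDerivAt_exp y)).div_const 2).sub (k2.const_mul (ww s))).congr_deriv ?_
    ring
  rw [hu, setIntegral_union (Ioc_disjoint_Ioi le_rfl) measurableSet_Ioi j1 j2,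
    ← setIntegral_congr_fun measurableSet_Ioc hc1, ← setIntegral_congr_fun measurableSet_Ioi hc2,
    e2, ← intervalIntegral.integral_of_le h0,
    intervalIntegral.integral_eq_sub_of_hasDerivAt (fun y _ => hder y) (hcont.intervalIntegrable _ _)]
  simp
  ring

lemma first_moment {s : ℝ} (h0 : 0 ≤ s) (h1 : s ≤ 1) :
    ∫ t in Ioi 0, t ^ (1:ℝ) * PP s t = ww s ^ 2 * (1 - ww s * (1 - (1 - s) ^ 3) / 3) := by
  rw [(PP_scale h0 h1 (by norm_num)).2]
  obtain ⟨i, e⟩ := SS_lin h0 h1 0 1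
  obtain ⟨-, a, -, b⟩ := exp_data (1 / 2)
  have : ∀ y : ℝ, y ^ (1:ℝ) * (exp (-y) / 2 + SS s y) = y * (1 / 2 * exp (-y)) + (0 + 1 * y) * SS s y :=
    fun y => by rw [rpow_one]; ring
  simp only [this]
  rw [integral_add a i, b, e]
  norm_num
  left
  unfold ww; ring

lemma exp_le_cubic' {y : ℝ} (h0 : 0 ≤ y) (h1 : y ≤ 4 / 5) :
    exp y ≤ 1 + y + y ^ 2 / 2 + 207 / 1000 * y ^ 3 := by
  have := Real.exp_bound' h0 (by linarith) (n := 6) (by norm_num)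
  simp [Finset.sum_range_succ, Nat.factorial] at this
  have y3 := pow_nonneg h0 3
  have a1 : y ^ 4 ≤ 4 / 5 * y ^ 3 := by nlinarith
  have a2 : y ^ 5 ≤ 4 / 5 * y ^ 4 := by nlinarith [pow_nonneg h0 4]
  have a3 : y ^ 6 ≤ 4 / 5 * y ^ 5 := by nlinarith [pow_nonneg h0 5]
  linarith

lemma aux_b {w W c : ℝ} (hw0 : 0 < w) (hwW : w ≤ W) (hW : W ≤ 7 / 5) (hc : c ≤ 1)
    (hF : 0 ≤ c * W ^ 3 - 3 * W ^ 2 + 3) : w ^ 2 * (1 - w * c / 3) ≤ 1 := by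
  have hW0 : 0 < W := by linarith
  have a1 : W * W ≤ 7 / 5 * W := mul_le_mul_of_nonneg_right hW hW0.le
  have a2 : w * w ≤ 7 / 5 * w := mul_le_mul_of_nonneg_right (by linarith) hw0.le
  have a3 : W * w ≤ 7 / 5 * w := mul_le_mul_of_nonneg_right hW hw0.le
  have p : 0 ≤ W * W + W * w + w * w := by positivity
  have q : c * (W * W + W * w + w * w) ≤ 1 * (W * W + W * w + w * w) :=
    mul_le_mul_of_nonneg_right hc p
  have h3 : 0 ≤ (W - w) * (3 * (W + w) - c * (W * W + W * w + w * w)) :=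
    mul_nonneg (by linarith) (by linarith)
  linarith [show (W - w) * (3 * (W + w) - c * (W * W + W * w + w * w))
    = 3 * W ^ 2 - 3 * w ^ 2 - c * W ^ 3 + c * w ^ 3 by ring,
    show w ^ 2 * (1 - w * c / 3) = w ^ 2 - c * w ^ 3 / 3 by ring]

set_option maxHeartbeats 1000000 in
lemma moment_b {s : ℝ} (h0 : 0 ≤ s) (h1 : s ≤ 4 / 5) :
    ∫ t in Ioi 0, t ^ (1:ℝ) * PP s t ≤ 1 := by
  rw [first_moment h0 (by linarith)]
  have hE := exp_le_cubic' h0 h1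
  set w := ww s with hw
  set W := (1 - s / 2) * (1 + s + s ^ 2 / 2 + 207 / 1000 * s ^ 3) with hW
  have hs : 0 ≤ 4 / 5 - s := by linarith
  have hwW : w ≤ W := by
    have := mul_le_mul_of_nonneg_left hE (show 0 ≤ 1 - s / 2 by linarith)
    rw [hw, hW]; unfold ww; linarith
  have hw0 : 0 < w := ww_pos (by linarith)
  have hW14 : W ≤ 7 / 5 := by
    rw [hW]
    nlinarith [pow_nonneg h0 2, pow_nonneg h0 3, pow_nonneg h0 4, mul_nonneg h0 hs,
      mul_nonneg (pow_nonneg h0 2) hs, mul_nonneg (pow_nonneg h0 3) hs]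
  set c := 1 - (1 - s) ^ 3 with hc
  have hc1 : c ≤ 1 := by
    have : 0 ≤ (1 - s) ^ 3 := pow_nonneg (by linarith) 3
    linarith
  have hF : 0 ≤ c * W ^ 3 - 3 * W ^ 2 + 3 := by
    have : c * W ^ 3 - 3 * W ^ 2 + 3 = s ^ 2 * (
      3662109375/268435456 * (s^0 * (4/5-s)^13) + 43732421875/268435456 * (s^1 * (4/5-s)^12)
       + 119553515625/134217728 * (s^2 * (4/5-s)^11)
       + 395292890625/134217728 * (s^3 * (4/5-s)^10)
       + 1758257109125/268435456 * (s^4 * (4/5-s)^9)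
       + 2766753220425/268435456 * (s^5 * (4/5-s)^8)
       + 788387956035/67108864 * (s^6 * (4/5-s)^7) + 654800348451/67108864 * (s^7 * (4/5-s)^6)
       + 982167560172873/167772160000 * (s^8 * (4/5-s)^5)
       + 415291632033669/167772160000 * (s^9 * (4/5-s)^4)
       + 1475725999964617/2097152000000 * (s^10 * (4/5-s)^3)
       + 1293929243199093/10485760000000 * (s^11 * (4/5-s)^2)
       + 1178317883502243/104857600000000 * (s^12 * (4/5-s)^1)
       + 178275568121067/524288000000000 * (s^13 * (4/5-s)^0)) := by
      rw [hc, hW]; ring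
    rw [this]; positivity
  exact aux_b hw0 hwW hW14 hc1 hF

lemma moment_b1 : 1 ≤ ∫ t in Ioi 0, t ^ (1:ℝ) * PP 1 t := by
  rw [first_moment zero_le_one le_rfl, ww_one]
  have h1 := exp_one_gt_d9
  have h2 := exp_one_lt_d9
  set e := exp 1
  norm_num
  have : 0 ≤ e / 2 - 1.359 := by linarith
  have : 0 ≤ 1.3592 - e / 2 := by linarith
  nlinarith

lemma rpow_34_le {y : ℝ} (hy : 0 ≤ y) : y ^ (3/4:ℝ) ≤ 1 / 4 + 3 / 4 * y := by
  have := Real.geom_mean_le_arith_mean2_weighted (w₁ := 1/4) (w₂ := 3/4) (p₁ := 1) (p₂ := y)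
    (by norm_num) (by norm_num) zero_le_one hy (by norm_num)
  simpa using this

lemma SS_diff {s : ℝ} (h0 : 0 ≤ s) (h1 : s ≤ 1) :
    ∫ y in Ioi 0, y ^ (3/4:ℝ) * SS s y ≤ (∫ y in Ioi 0, y ^ (3/4:ℝ) * SS 1 y)
      + (ww 1 - ww s) * (s ^ 2 / 8 + s ^ 3 / 4) + exp s * (1 - s) ^ 3 / 2 := by
  have hu : Ioi (0:ℝ) = Ioc 0 s ∪ Ioi s := (Ioc_union_Ioi_eq_Ioi h0).symm
  have is := SS_rpow_integrable h0 h1 (r := 3/4) (by norm_num)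
  have i1 := SS_rpow_integrable zero_le_one le_rfl (r := 3/4) (by norm_num)
  have hww := ww_mono h1 le_rfl
  have id : IntegrableOn (fun y => y ^ (3/4:ℝ) * SS s y - y ^ (3/4:ℝ) * SS 1 y) (Ioi 0) := is.sub i1
  have ed : ∫ y in Ioi 0, (y ^ (3/4:ℝ) * SS s y - y ^ (3/4:ℝ) * SS 1 y)
      = (∫ y in Ioi 0, y ^ (3/4:ℝ) * SS s y) - ∫ y in Ioi 0, y ^ (3/4:ℝ) * SS 1 y := integral_sub is i1
  have j1 := id.mono_set (s := Ioc 0 s) (by rw [hu]; exact subset_union_left)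
  have j2 := id.mono_set (s := Ioi s) (by rw [hu]; exact subset_union_right)
  rw [hu, setIntegral_union (Ioc_disjoint_Ioi le_rfl) measurableSet_Ioi j1 j2, ← hu] at ed
  obtain ⟨t1, t2⟩ := K_tail h1 (1/4) (3/4)
  have b2 := setIntegral_mono_on j2 t1 measurableSet_Ioi (by
    intro y hy
    have hy : s < y := hy
    have hy0 : 0 ≤ y := by linarith
    have k1 := mul_nonneg (rpow_nonneg hy0 (3/4)) (SS_nonneg zero_le_one le_rfl hy0)
    have k2 : SS s y = exp s * (1 - s) ^ 2 / 2 * qq (1 - s) (y - s) := by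
      simp only [SS, not_le.2 hy, if_false]
    have k3 := mul_le_mul_of_nonneg_right (rpow_34_le hy0) (SS_nonneg h0 h1 hy0)
    have k4 : (1 / 4 + 3 / 4 * y) * SS s y = exp s * (1 - s) ^ 2 / 2 * ((1 / 4 + 3 / 4 * y) * qq (1 - s) (y - s)) := by
      rw [k2]; ring
    linarith)
  have hcont : Continuous fun y : ℝ => (ww 1 - ww s) * ((1 / 4 + 3 / 4 * y) * y) := by fun_prop
  have b1 := setIntegral_mono_on j1 (hcont.integrableOn_Icc.mono_set Ioc_subset_Icc_self) measurableSet_Ioc (by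
    intro y hy
    have hy0 : 0 ≤ y := hy.1.le
    have k1 : SS s y - SS 1 y = (ww 1 - ww s) * y := by
      simp only [SS, hy.2, hy.2.trans h1, if_true]; ring
    have k2 := mul_le_mul_of_nonneg_right (rpow_34_le hy0) (mul_nonneg (sub_nonneg.2 hww) hy0)
    rw [← mul_sub, k1]
    linarith)
  have hder : ∀ y : ℝ, HasDerivAt (fun y => (ww 1 - ww s) * (y ^ 2 / 8 + y ^ 3 / 4))
      ((ww 1 - ww s) * ((1 / 4 + 3 / 4 * y) * y)) y := by
    intro y
    refine ((((hasDerivAt_pow 2 y).div_const 8).add ((hasDerivAt_pow 3 y).div_const 4)).const_mul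
      (ww 1 - ww s)).congr_deriv ?_
    push_cast; ring
  rw [← intervalIntegral.integral_of_le (f := fun y => (ww 1 - ww s) * ((1 / 4 + 3 / 4 * y) * y)) h0,
    intervalIntegral.integral_eq_sub_of_hasDerivAt (fun y _ => hder y)
    (hcont.intervalIntegrable _ _)] at b1
  rw [t2] at b2
  norm_num at b1 b2
  linarith

noncomputable def N1 : ℝ := ∫ y in Ioi 0, y ^ (3/4:ℝ) * SS 1 y

lemma N1_ge : 1 / 2 - exp 1 / 6 ≤ N1 := by
  obtain ⟨i, e⟩ := SS_lin zero_le_one le_rfl 0 1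
  have : ∫ y in Ioi 0, (0 + 1 * y) * SS 1 y ≤ N1 := by
    refine setIntegral_mono_on i (SS_rpow_integrable zero_le_one le_rfl (by norm_num)) measurableSet_Ioi ?_
    intro y hy
    have hy : 0 < y := hy
    by_cases h : y ≤ 1
    · refine mul_le_mul_of_nonneg_right ?_ (SS_nonneg zero_le_one le_rfl hy.le)
      have := rpow_le_rpow_of_exponent_ge hy h (show (3/4:ℝ) ≤ 1 by norm_num)
      rw [rpow_one] at this
      linarith
    · have : SS 1 y = 0 := by simp [SS, h, qq]
      rw [this]; simp
  rw [e, ww_one] at this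
  norm_num at this
  linarith

lemma N1_le : N1 ≤ 329 / 5000 := by
  obtain ⟨i, e⟩ := SS_lin zero_le_one le_rfl (343 / 4000) (343 / 1000 * (3 / 4) / (2401 / 10000))
  have : N1 ≤ ∫ y in Ioi 0, (343 / 4000 + (343 / 1000 * (3 / 4) / (2401 / 10000)) * y) * SS 1 y := by
    refine setIntegral_mono_on (SS_rpow_integrable zero_le_one le_rfl (by norm_num)) i measurableSet_Ioi ?_
    intro y hy
    have hy : 0 < y := hy
    refine mul_le_mul_of_nonneg_right ?_ (SS_nonneg zero_le_one le_rfl hy.le)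
    have h1 := rpow_34_le (y := y / (2401 / 10000)) (by positivity)
    rw [div_rpow hy.le (by norm_num)] at h1
    have h2 : (2401 / 10000 : ℝ) ^ (3/4:ℝ) = 343 / 1000 := by
      have : (2401 / 10000 : ℝ) = (7 / 10) ^ (4:ℝ) := by norm_num
      rw [this, ← rpow_mul (by norm_num)]
      norm_num
    rw [h2, div_le_iff₀ (by norm_num)] at h1
    linarith
  rw [e, ww_one] at this
  norm_num at this
  have h1 := exp_one_gt_d9
  have h2 := exp_one_lt_d9
  linarith

lemma Gamma_lower : 21 / 25 ≤ Real.Gamma (7 / 4) := by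
  have h := Real.Gamma_mul_add_mul_le_rpow_Gamma_mul_rpow_Gamma (s := 7/4) (t := 3) (a := 4/5) (b := 1/5)
    (by norm_num) (by norm_num) (by norm_num) (by norm_num) (by norm_num)
  have e : (4/5 * (7/4) + 1/5 * 3 : ℝ) = 2 := by norm_num
  have g3 : Real.Gamma 3 = 2 := by
    have := Real.Gamma_nat_eq_factorial 2
    norm_num at this
    simpa [Nat.factorial] using this
  rw [e, Real.Gamma_two, g3] at h
  have hG : 0 < Real.Gamma (7/4) := Real.Gamma_pos_of_pos (by norm_num)
  have h5 := pow_le_pow_left₀ zero_le_one h 5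
  rw [mul_pow, ← rpow_natCast, ← rpow_natCast, ← rpow_mul hG.le, ← rpow_natCast, ← rpow_mul (by norm_num)] at h5
  norm_num at h5
  by_contra hc
  have : Real.Gamma (7/4) ^ 4 ≤ (21/25) ^ 4 := pow_le_pow_left₀ hG.le (not_le.1 hc).le 4
  have h6 : Real.Gamma (7/4) ^ (4:ℝ) = Real.Gamma (7/4) ^ 4 := by
    rw [← rpow_natCast]; norm_num
  try rw [h6] at h5
  norm_num at this
  linarith

lemma exp_rpow_34 : ∫ y in Ioi 0, y ^ (3/4:ℝ) * exp (-y) = Real.Gamma (7 / 4) := by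
  rw [Real.Gamma_eq_integral (by norm_num)]
  refine setIntegral_congr_fun measurableSet_Ioi fun y _ => ?_
  norm_num [mul_comm]

lemma QQ_34 {s : ℝ} (h0 : 0 ≤ s) (h1 : s ≤ 1) :
    ∫ y in Ioi 0, y ^ (3/4:ℝ) * (exp (-y) / 2 + SS s y)
      = Real.Gamma (7 / 4) / 2 + ∫ y in Ioi 0, y ^ (3/4:ℝ) * SS s y := by
  have : ∀ y : ℝ, y ^ (3/4:ℝ) * (exp (-y) / 2 + SS s y)
      = 1 / 2 * (y ^ (3/4:ℝ) * exp (-y)) + y ^ (3/4:ℝ) * SS s y := fun y => by ring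
  simp only [this]
  rw [integral_add ((exp_rpow_integrable (by norm_num)).const_mul _)
    (SS_rpow_integrable h0 h1 (by norm_num)), integral_const_mul, exp_rpow_34]
  ring

lemma moment_d : ∫ t in Ioi 0, t ^ (3/4:ℝ) * PP 1 t ≤ Real.Gamma (7 / 4) := by
  rw [(PP_scale zero_le_one le_rfl (by norm_num)).2, QQ_34 zero_le_one le_rfl]
  have hG := Gamma_lower
  have hN := N1_le
  unfold N1 at hN
  have hN0 := N1_ge
  unfold N1 at hN0
  have h2 := exp_one_lt_d9
  have hw : ww 1 ^ (3/4 + 1 : ℝ) ≤ 214 / 125 := by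
    have hw1 : ww 1 ≤ 1.35915 := by rw [ww_one]; linarith
    have hw0 := ww_pos (le_refl (1:ℝ))
    have h7 := pow_le_pow_left₀ hw0.le hw1 7
    have h8 : ww 1 ^ (3/4 + 1 : ℝ) = (ww 1 ^ 7) ^ (1/4:ℝ) := by
      rw [← rpow_natCast, ← rpow_mul hw0.le]; norm_num
    have h9 : (214 / 125 : ℝ) = ((214 / 125) ^ 4) ^ (1/4:ℝ) := by
      rw [← rpow_natCast, ← rpow_mul (by norm_num)]; norm_num
    rw [h8, h9]
    refine rpow_le_rpow (by positivity) (h7.trans (by norm_num)) (by norm_num)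
  refine (mul_le_mul_of_nonneg_right hw (by linarith)).trans ?_
  linarith

lemma scalar_c {τ r s : ℝ} (hs : s = 1 - τ) (h0 : 0 ≤ τ) (h1 : τ ≤ 1 / 5) (hr : r = (1 + τ) * exp (-τ)) :
    (1 - r) * (s ^ 2 / 8 + s ^ 3 / 4) + exp (-τ) * τ ^ 3 ≤ 687 / 2000 * ((1 - r) * (1 + 3 / 4 * r)) := by
  have e1 := exp_neg_le_quartic h0
  have e2 := exp_neg_ge_cubic h0 (by linarith)
  have hτ : 0 ≤ 1 / 5 - τ := by linarith
  have p3 := pow_nonneg h0 3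
  have p4 := pow_nonneg h0 4
  have r1 : τ ^ 2 / 2 - τ ^ 3 / 3 ≤ 1 - r := by
    have := mul_le_mul_of_nonneg_left e1 (show 0 ≤ 1 + τ by linarith)
    rw [hr]
    have q : (1 + τ) * (1 - τ + τ ^ 2 / 2 - τ ^ 3 / 6 + τ ^ 4 / 24) ≤ 1 - τ ^ 2 / 2 + τ ^ 3 / 3 := by
      nlinarith [mul_nonneg p4 hτ]
    linarith
  have r2 : 1 - τ ^ 2 / 2 ≤ r := by
    have := mul_le_mul_of_nonneg_left e2 (show 0 ≤ 1 + τ by linarith)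
    rw [hr]
    have q : 1 - τ ^ 2 / 2 ≤ (1 + τ) * (1 - τ + τ ^ 2 / 2 - τ ^ 3 / 6) := by
      nlinarith [mul_nonneg p3 hτ]
    linarith
  have e3 : exp (-τ) ≤ 1 - τ + τ ^ 2 / 2 := by nlinarith [mul_nonneg p3 hτ]
  have k : τ * (1 - τ + τ ^ 2 / 2) ≤ (1 / 2 - τ / 3) *
      (687 / 2000 * (7 / 4 - 3 / 8 * τ ^ 2) - (1 - τ) ^ 2 / 8 - (1 - τ) ^ 3 / 4) := by
    have : (1 / 2 - τ / 3) *
      (687 / 2000 * (7 / 4 - 3 / 8 * τ ^ 2) - (1 - τ) ^ 2 / 8 - (1 - τ) ^ 3 / 4) - τ * (1 - τ + τ ^ 2 / 2)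
      = (
      9045/128 * (τ^0 * (1/5-τ)^4) + 13487/64 * (τ^1 * (1/5-τ)^3)
       + 815377/3840 * (τ^2 * (1/5-τ)^2) + 11239/150 * (τ^3 * (1/5-τ)^1)
       + 49457/19200 * (τ^4 * (1/5-τ)^0)) := by ring
    have h : 0 ≤ (1 / 2 - τ / 3) *
      (687 / 2000 * (7 / 4 - 3 / 8 * τ ^ 2) - (1 - τ) ^ 2 / 8 - (1 - τ) ^ 3 / 4) - τ * (1 - τ + τ ^ 2 / 2) := by
      rw [this]; positivity
    linarith
  have bpos : 0 ≤ 687 / 2000 * (7 / 4 - 3 / 8 * τ ^ 2) - (1 - τ) ^ 2 / 8 - (1 - τ) ^ 3 / 4 := by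
    by_contra hc
    have h2 : 0 ≤ τ * (1 - τ + τ ^ 2 / 2) := mul_nonneg h0 (by nlinarith)
    have := mul_neg_of_pos_of_neg (show 0 < 1 / 2 - τ / 3 by linarith) (not_le.1 hc)
    linarith
  have b2 : 687 / 2000 * (7 / 4 - 3 / 8 * τ ^ 2) - (1 - τ) ^ 2 / 8 - (1 - τ) ^ 3 / 4
      ≤ 687 / 2000 * (1 + 3 / 4 * r) - s ^ 2 / 8 - s ^ 3 / 4 := by rw [hs]; linarith
  have r0 : 0 ≤ τ ^ 2 / 2 - τ ^ 3 / 3 := by nlinarith [sq_nonneg τ]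
  have m1 := mul_le_mul r1 b2 bpos (r0.trans r1)
  have m2 := mul_le_mul_of_nonneg_left k (sq_nonneg τ)
  have m3 := mul_le_mul_of_nonneg_right e3 p3
  nlinarith

lemma moment_c {s : ℝ} (h0 : 4 / 5 ≤ s) (h1 : s ≤ 1) :
    ∫ t in Ioi 0, t ^ (3/4:ℝ) * PP s t ≤ ∫ t in Ioi 0, t ^ (3/4:ℝ) * PP 1 t := by
  have hs0 : 0 ≤ s := by linarith
  rw [(PP_scale zero_le_one le_rfl (by norm_num)).2, QQ_34 zero_le_one le_rfl,
    (PP_scale hs0 h1 (by norm_num)).2, QQ_34 hs0 h1]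
  have hd := SS_diff hs0 h1
  set A := Real.Gamma (7 / 4) / 2 + ∫ y in Ioi 0, y ^ (3/4:ℝ) * SS 1 y with hA
  have hG := Gamma_lower
  have hN0 := N1_ge
  unfold N1 at hN0
  have h2 := exp_one_lt_d9
  have hw1 := ww_pos (le_refl (1:ℝ))
  have hw := ww_pos h1
  have hA0 : 687 / 2000 * ww 1 ≤ A := by rw [hA, ww_one]; linarith
  set r := ww s / ww 1 with hr
  have hr0 : 0 < r := by rw [hr]; positivity
  have hr1 : r ≤ 1 := by rw [hr, div_le_one hw1]; exact ww_mono h1 le_rfl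
  have hwr : ww s = r * ww 1 := by rw [hr]; field_simp
  have hre : r = (1 + (1 - s)) * exp (-(1 - s)) := by
    rw [hr, ww_one]; unfold ww
    have : exp s = exp 1 * exp (-(1 - s)) := by rw [← exp_add]; congr 1; ring
    rw [this]; field_simp; ring
  have key := scalar_c (s := s) (τ := 1 - s) (by ring) (by linarith) (by linarith) hre
  have hexp : exp s / 2 = ww 1 * exp (-(1 - s)) := by
    rw [ww_one]
    have : exp s = exp 1 * exp (-(1 - s)) := by rw [← exp_add]; congr 1; ring
    rw [this]; ring
  set δ := (ww 1 - ww s) * (s ^ 2 / 8 + s ^ 3 / 4) + exp s * (1 - s) ^ 3 / 2 with hδ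
  have hδ0 : 0 ≤ δ := by
    have := sub_nonneg.2 (ww_mono h1 le_rfl)
    have : 0 ≤ 1 - s := by linarith
    positivity
  have hδ1 : δ ≤ A * ((1 - r) * (1 + 3 / 4 * r)) := by
    have e : δ = ww 1 * ((1 - r) * (s ^ 2 / 8 + s ^ 3 / 4) + exp (-(1 - s)) * (1 - s) ^ 3) := by
      rw [hδ, hwr]; linear_combination (1 - s) ^ 3 * hexp
    rw [e]
    have k1 := mul_le_mul_of_nonneg_left key hw1.le
    have k2 := mul_le_mul_of_nonneg_right hA0 (show 0 ≤ (1 - r) * (1 + 3 / 4 * r) from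
      mul_nonneg (by linarith) (by linarith))
    linarith
  have hpow : ww s ^ (3/4 + 1 : ℝ) ≤ r * (1 / 4 + 3 / 4 * r) * ww 1 ^ (3/4 + 1 : ℝ) := by
    rw [hwr, mul_rpow hr0.le hw1.le, rpow_add hr0, rpow_one, mul_comm (r ^ (3/4:ℝ)) r]
    exact mul_le_mul_of_nonneg_right (mul_le_mul_of_nonneg_left (rpow_34_le hr0.le) hr0.le) (by positivity)
  have hApos : 0 ≤ A := le_trans (by positivity) hA0
  have hAd : Real.Gamma (7 / 4) / 2 + ∫ y in Ioi 0, y ^ (3/4:ℝ) * SS s y ≤ A + δ := by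
    rw [hA, hδ]; linarith
  calc _ ≤ ww s ^ (3/4 + 1 : ℝ) * (A + δ) := mul_le_mul_of_nonneg_left hAd (by positivity)
    _ ≤ r * (1 / 4 + 3 / 4 * r) * ww 1 ^ (3/4 + 1 : ℝ) * (A + δ) :=
        mul_le_mul_of_nonneg_right hpow (by linarith)
    _ = ww 1 ^ (3/4 + 1 : ℝ) * (r * (1 / 4 + 3 / 4 * r) * (A + δ)) := by ring
    _ ≤ ww 1 ^ (3/4 + 1 : ℝ) * A := by
        refine mul_le_mul_of_nonneg_left ?_ (by positivity)
        have q1 : r * (1 / 4 + 3 / 4 * r) ≤ 1 := by nlinarith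
        have q2 := mul_le_mul_of_nonneg_right q1 hδ0
        nlinarith

lemma up_one {s : ℝ} (h0 : 0 ≤ s) (h1 : s ≤ 1) {r r' : ℝ} (hr : -1 < r) (hrr : r ≤ r')
    (h : ∫ t in Ioi 0, t ^ r * PP s t ≤ ∫ t in Ioi 0, t ^ r * PP 1 t) :
    ∫ t in Ioi 0, t ^ r' * PP s t ≤ ∫ t in Ioi 0, t ^ r' * PP 1 t := by
  rcases h1.eq_or_lt with rfl | h1'
  · exact le_rfl
  have a := (PP_scale h0 h1 hr).1
  have a' := (PP_scale h0 h1 (hr.trans_le hrr)).1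
  have b := (PP_scale zero_le_one le_rfl hr).1
  have b' := (PP_scale zero_le_one le_rfl (hr.trans_le hrr)).1
  have := (upset_moment (Δ := fun t => PP 1 t - PP s t) hrr
    (fun x y hx hxy hh => cross_one h0 h1' hx hxy hh)
    (by simp only [mul_sub]; exact b.sub a) (by simp only [mul_sub]; exact b'.sub a')).1
  simp only [mul_sub] at this
  rw [integral_sub b a, integral_sub b' a'] at this
  linarith [this (by linarith)]

lemma up_two {s : ℝ} (h0 : 0 ≤ s) (h1 : s ≤ 1) {r r' : ℝ} (hr : -1 < r) (hrr : r ≤ r')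
    (h : ∫ t in Ioi 0, t ^ r' * PP s t ≤ ∫ t in Ioi 0, t ^ r' * exp (-t)) :
    ∫ t in Ioi 0, t ^ r * PP s t ≤ ∫ t in Ioi 0, t ^ r * exp (-t) := by
  have a := (PP_scale h0 h1 hr).1
  have a' := (PP_scale h0 h1 (hr.trans_le hrr)).1
  have b := exp_rpow_integrable hr
  have b' := exp_rpow_integrable (hr.trans_le hrr)
  have := (upset_moment (Δ := fun t => PP s t - exp (-t)) hrr
    (fun x y hx hxy hh => cross_two h0 h1 hx hxy hh)
    (by simp only [mul_sub]; exact a.sub b) (by simp only [mul_sub]; exact a'.sub b')).2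
  simp only [mul_sub] at this
  rw [integral_sub a b, integral_sub a' b'] at this
  linarith [this (by linarith)]

lemma coreB {s : ℝ} (h0 : 0 ≤ s) (h1 : s ≤ 1) {r : ℝ} (hr : -1 < r) :
    ∫ t in Ioi 0, t ^ r * PP s t ≤
      max (∫ t in Ioi 0, t ^ r * exp (-t)) (∫ t in Ioi 0, t ^ r * PP 1 t) := by
  rcases le_total s (4/5) with h | h
  · have hb := moment_b h0 h
    rcases le_total r 1 with hr1 | hr1
    · refine le_max_of_le_left (up_two h0 h1 hr hr1 (hb.trans ?_))
      have := (exp_data 1).2.2.2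
      simp only [one_mul] at this
      simp only [rpow_one]
      rw [this]
    · exact le_max_of_le_right (up_one h0 h1 (by norm_num) hr1 (hb.trans moment_b1))
  · have hc := moment_c h h1
    rcases le_total r (3/4) with hr1 | hr1
    · refine le_max_of_le_left (up_two h0 h1 hr hr1 (hc.trans ?_))
      rw [exp_rpow_34]; exact moment_d
    · exact le_max_of_le_right (up_one h0 h1 (by norm_num) hr1 hc)

lemma layer_point {p a : ℝ} (hp : 1 < p) (ha : 0 ≤ a) :
    ∫⁻ t in Ioi (0:ℝ), ENNReal.ofReal (p * (p - 1) * t ^ (p - 2)) * ENNReal.ofReal (a - t)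
      = ENNReal.ofReal (a ^ p) := by
  have e1 : ∫⁻ t in Ioi (0:ℝ), ENNReal.ofReal (p * (p - 1) * t ^ (p - 2)) * ENNReal.ofReal (a - t)
      = ∫⁻ t in Ioc 0 a, ENNReal.ofReal (p * (p - 1) * t ^ (p - 2)) * ENNReal.ofReal (a - t) := by
    rw [← lintegral_indicator measurableSet_Ioi, ← lintegral_indicator measurableSet_Ioc]
    refine lintegral_congr fun x => ?_
    by_cases hx0 : 0 < x
    · by_cases hxa : x ≤ a
      · rw [indicator_of_mem (show x ∈ Ioi 0 from hx0), indicator_of_mem (show x ∈ Ioc 0 a from ⟨hx0, hxa⟩)]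
      · rw [indicator_of_mem (show x ∈ Ioi 0 from hx0), indicator_of_notMem (fun hh => hxa hh.2),
          ENNReal.ofReal_of_nonpos (show a - x ≤ 0 by linarith), mul_zero]
    · rw [indicator_of_notMem (show x ∉ Ioi 0 from fun hh => hx0 hh), indicator_of_notMem (fun hh => hx0 hh.1)]
  rw [e1]
  have e2 : ∫⁻ t in Ioc 0 a, ENNReal.ofReal (p * (p - 1) * t ^ (p - 2)) * ENNReal.ofReal (a - t)
      = ∫⁻ t in Ioc 0 a, ENNReal.ofReal (p * (p - 1) * (a * t ^ (p - 2) - t ^ (p - 1))) := by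
    refine setLIntegral_congr_fun measurableSet_Ioc fun t ht => ?_
    have ht0 : 0 < t := ht.1
    rw [← ENNReal.ofReal_mul (mul_nonneg (by nlinarith) (rpow_nonneg ht0.le _))]
    congr 1
    rw [show p - 1 = (p - 2) + 1 by ring, rpow_add_one ht0.ne']
    ring
  rw [e2]
  have i1 : IntervalIntegrable (fun t : ℝ => t ^ (p - 2)) volume 0 a :=
    intervalIntegral.intervalIntegrable_rpow' (by linarith)
  have i2 : IntervalIntegrable (fun t : ℝ => t ^ (p - 1)) volume 0 a :=
    intervalIntegral.intervalIntegrable_rpow' (by linarith)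
  have ii := ((i1.const_mul a).sub i2).const_mul (p * (p - 1))
  rw [← ofReal_integral_eq_lintegral_ofReal]
  · rw [← intervalIntegral.integral_of_le ha, intervalIntegral.integral_const_mul,
      intervalIntegral.integral_sub (i1.const_mul a) i2, intervalIntegral.integral_const_mul,
      integral_rpow (Or.inl (by linarith)), integral_rpow (Or.inl (by linarith)),
      zero_rpow (by linarith), zero_rpow (by linarith)]
    congr 1
    rcases ha.eq_or_lt with rfl | ha0
    · rw [zero_rpow (by linarith), zero_rpow (by linarith), zero_rpow (by linarith)]; simp
    have : a * a ^ (p - 2 + 1) = a ^ p := by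
      rw [mul_comm, ← rpow_add_one ha0.ne']; congr 1; ring
    have hp1 : p - 1 ≠ 0 := by linarith
    have hp0 : p ≠ 0 := by linarith
    rw [show p - 1 + 1 = p by ring, sub_zero, sub_zero, ← mul_div_assoc, this,
      show p - 2 + 1 = p - 1 by ring]
    field_simp
    ring
  · exact (intervalIntegrable_iff_integrableOn_Ioc_of_le ha).1 ii
  · filter_upwards [ae_restrict_mem measurableSet_Ioc] with t ht
    have ht0 : 0 < t := ht.1
    have : t ^ (p - 1) = t * t ^ (p - 2) := by
      rw [mul_comm, ← rpow_add_one ht0.ne']; congr 1; ring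
    rw [this, ← sub_mul]
    have h2 : 0 ≤ a - t := sub_nonneg.2 ht.2
    have h3 : 0 ≤ p - 1 := by linarith
    have h4 : 0 ≤ p := by linarith
    have := rpow_nonneg ht0.le (p - 2)
    positivity

lemma layer_cake {μ : Measure ℝ} [SFinite μ] {p : ℝ} (hp : 1 < p) {Z : ℝ → ℝ} {h : ℝ → ENNReal}
    (hZ : Measurable Z) (hh : Measurable h) (hZ0 : ∀ x, 0 ≤ Z x) :
    ∫⁻ x, ENNReal.ofReal (Z x ^ p) * h x ∂μ
      = ∫⁻ t in Ioi (0:ℝ), ENNReal.ofReal (p * (p - 1) * t ^ (p - 2)) *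
          ∫⁻ x, ENNReal.ofReal (Z x - t) * h x ∂μ := by
  have m1 : Measurable fun t : ℝ => ENNReal.ofReal (p * (p - 1) * t ^ (p - 2)) := by fun_prop
  have m2 : Measurable fun q : ℝ × ℝ => ENNReal.ofReal (Z q.1 - q.2) * h q.1 := by fun_prop
  calc _ = ∫⁻ x, (∫⁻ t in Ioi (0:ℝ), ENNReal.ofReal (p * (p - 1) * t ^ (p - 2)) *
        (ENNReal.ofReal (Z x - t) * h x)) ∂μ := by
        refine lintegral_congr fun x => ?_
        rw [← layer_point hp (hZ0 x), ← lintegral_mul_const]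
        · simp only [mul_assoc]
        · fun_prop
    _ = _ := by
        rw [lintegral_lintegral_swap]
        · refine lintegral_congr fun t => ?_
          rw [lintegral_const_mul]
          fun_prop
        · exact ((m1.comp measurable_snd).mul m2).aemeasurable

lemma inner_one_left {y : ℝ} (hy : 0 ≤ y) :
    IntegrableOn (fun x => max (|x - 1| - y) 0 * exp (-x)) (Ioc 0 1) ∧
    ∫ x in Ioc 0 1, max (|x - 1| - y) 0 * exp (-x) = 2 / exp 1 * SS 1 y := by
  have hcont : Continuous fun x : ℝ => max (|x - 1| - y) 0 * exp (-x) := by fun_prop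
  refine ⟨hcont.integrableOn_Icc.mono_set Ioc_subset_Icc_self, ?_⟩
  have hq : ∀ u, qq (1 - 1) u = 0 := fun u => by simp [qq]
  by_cases h : y ≤ 1
  · rw [setIntegral_eq_of_subset_of_forall_sdiff_eq_zero measurableSet_Ioc
      (Ioc_subset_Ioc_right (show 1 - y ≤ 1 by linarith))]
    · have e : ∫ x in Ioc 0 (1 - y), max (|x - 1| - y) 0 * exp (-x)
          = ∫ x in Ioc 0 (1 - y), (1 - y - x) * exp (-x) := by
        refine setIntegral_congr_fun measurableSet_Ioc fun x hx => ?_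
        have h2 := hx.2
        have h1 := hx.1
        rw [abs_of_nonpos (by linarith), max_eq_left (by linarith)]
        ring
      have hder : ∀ x : ℝ, HasDerivAt (fun x => (x + y) * exp (-x)) ((1 - y - x) * exp (-x)) x := by
        intro x
        refine (((hasDerivAt_id' x).add_const y).mul ((hasDerivAt_neg x).exp)).congr_deriv ?_
        ring
      rw [e, ← intervalIntegral.integral_of_le (f := fun x => (1 - y - x) * exp (-x)) (by linarith),
        intervalIntegral.integral_eq_sub_of_hasDerivAt (fun x _ => hder x)
        ((by fun_prop : Continuous fun x : ℝ => (1 - y - x) * exp (-x)).intervalIntegrable _ _)]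
      simp only [SS, h, if_true, ww_one]
      rw [show -(1 - y) = y - 1 by ring, exp_sub]
      have := exp_pos 1
      field_simp
      simp [mul_comm]
    · intro x hx
      have h1 := hx.1.1
      have h2 := hx.1.2
      have h3 : 1 - y < x := by
        by_contra hcon
        exact hx.2 ⟨h1, not_lt.1 hcon⟩
      rw [abs_of_nonpos (by linarith), max_eq_right (by linarith), zero_mul]
  · simp only [SS, h, if_false, hq, mul_zero]
    rw [setIntegral_congr_fun (g := fun _ => 0) measurableSet_Ioc]
    · simp
    · intro x hx
      have h1 := hx.1
      have h2 := hx.2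
      beta_reduce
      rw [abs_of_nonpos (by linarith), max_eq_right (by linarith), zero_mul]

lemma inner_one_right {y : ℝ} (hy : 0 ≤ y) :
    IntegrableOn (fun x => max (|x - 1| - y) 0 * exp (-x)) (Ioi 1) ∧
    ∫ x in Ioi 1, max (|x - 1| - y) 0 * exp (-x) = 2 / exp 1 * (exp (-y) / 2) := by
  have hsub : Ioi (1 + y) ⊆ Ioi 1 := Ioi_subset_Ioi (by linarith)
  obtain ⟨i, e⟩ := expint (τ := 1) (c := 1 + y) (d := 1 + y) (s := 0) one_pos le_rfl
  have hc : ∀ x ∈ Ioi (1 + y), (x - (1 + y)) * exp (-(x - 0) / 1) = max (|x - 1| - y) 0 * exp (-x) := by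
    intro x hx
    have : 1 + y < x := hx
    rw [abs_of_nonneg (by linarith), max_eq_left (by linarith), sub_zero, div_one]
    ring
  have hz : ∀ x ∈ Ioi (1:ℝ) \ Ioi (1 + y), max (|x - 1| - y) 0 * exp (-x) = 0 := by
    intro x hx
    have h1 : 1 < x := hx.1
    have h2 : x ≤ 1 + y := not_lt.1 hx.2
    rw [abs_of_nonneg (by linarith), max_eq_right (by linarith), zero_mul]
  constructor
  · exact (i.congr_fun hc measurableSet_Ioi).of_forall_sdiff_eq_zero measurableSet_Ioi hz
  · rw [setIntegral_eq_of_subset_of_forall_sdiff_eq_zero measurableSet_Ioi hsub hz,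
      ← setIntegral_congr_fun measurableSet_Ioi hc, e]
    rw [show -(1 + y - 0) / 1 = -y - 1 by ring, exp_sub]
    have := exp_pos 1
    field_simp
    ring

lemma inner_one {y : ℝ} (hy : 0 ≤ y) :
    IntegrableOn (fun x => max (|x - 1| - y) 0 * exp (-x)) (Ioi 0) ∧
    ∫ x in Ioi 0, max (|x - 1| - y) 0 * exp (-x) = 2 / exp 1 * (exp (-y) / 2 + SS 1 y) := by
  have hu : Ioi (0:ℝ) = Ioc 0 1 ∪ Ioi 1 := (Ioc_union_Ioi_eq_Ioi zero_le_one).symm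
  obtain ⟨i1, e1⟩ := inner_one_left hy
  obtain ⟨i2, e2⟩ := inner_one_right hy
  rw [hu]
  refine ⟨i1.union i2, ?_⟩
  rw [setIntegral_union (Ioc_disjoint_Ioi le_rfl) measurableSet_Ioi i1 i2, e1, e2]
  ring

lemma GG_lint {s : ℝ} (h0 : 0 ≤ s) (h1 : s ≤ 1) {p C : ℝ} (hp : 1 < p) (hC : 0 ≤ C) :
    ∫⁻ t in Ioi (0:ℝ), ENNReal.ofReal (p * (p - 1) * t ^ (p - 2)) *
      ENNReal.ofReal (C * (exp (-t) / 2 + SS s t))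
    = ENNReal.ofReal (p * (p - 1) * C * ∫ t in Ioi 0, t ^ (p - 2) * (exp (-t) / 2 + SS s t)) := by
  have hpp : 0 ≤ p * (p - 1) := mul_nonneg (by linarith) (by linarith)
  rw [← integral_const_mul, ofReal_integral_eq_lintegral_ofReal
    ((QQ_integrable h0 h1 (by linarith)).const_mul _)]
  · refine setLIntegral_congr_fun measurableSet_Ioi fun t ht => ?_
    have ht : 0 < t := ht
    rw [← ENNReal.ofReal_mul (mul_nonneg hpp (rpow_nonneg ht.le _))]
    congr 1; ring
  · filter_upwards [ae_restrict_mem measurableSet_Ioi] with t ht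
    have ht : 0 < t := ht
    have := SS_nonneg h0 h1 ht.le
    have := rpow_nonneg ht.le (p - 2)
    have := exp_pos (-t)
    simp only [Pi.zero_apply]
    positivity

lemma ofReal_mul_ofReal (a : ℝ) {b : ℝ} (_ : 0 ≤ b) :
    ENNReal.ofReal a * ENNReal.ofReal b = ENNReal.ofReal (max a 0 * b) := by
  rw [ENNReal.ofReal_mul (le_max_right _ _), ENNReal.ofReal_max]; simp

lemma M_one {p : ℝ} (hp : 1 < p) :
    (exp 1 / 2) ^ p * ∫ x in Ioi (0:ℝ), |x - 1| ^ p * exp (-x)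
      = p * (p - 1) * ∫ t in Ioi 0, t ^ (p - 2) * PP 1 t := by
  have L := layer_cake (μ := volume.restrict (Ioi (0:ℝ))) hp (Z := fun x => |x - 1|)
    (h := fun x => ENNReal.ofReal (exp (-x))) (by fun_prop) (by fun_prop) (fun x => abs_nonneg _)
  have e : ∫⁻ t in Ioi (0:ℝ), ENNReal.ofReal (p * (p - 1) * t ^ (p - 2)) *
          ∫⁻ x in Ioi (0:ℝ), ENNReal.ofReal (|x - 1| - t) * ENNReal.ofReal (exp (-x))
      = ∫⁻ t in Ioi (0:ℝ), ENNReal.ofReal (p * (p - 1) * t ^ (p - 2)) *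
      ENNReal.ofReal (2 / exp 1 * (exp (-t) / 2 + SS 1 t)) := by
    refine setLIntegral_congr_fun measurableSet_Ioi fun t ht => ?_
    have ht : 0 < t := ht
    obtain ⟨i, e⟩ := inner_one ht.le
    rw [← e, ofReal_integral_eq_lintegral_ofReal i]
    · simp only [ofReal_mul_ofReal _ (exp_pos _).le]
    · exact Filter.Eventually.of_forall fun x => mul_nonneg (le_max_right _ _) (exp_pos _).le
  rw [e, GG_lint zero_le_one le_rfl hp (by positivity)] at L
  have hpp : 0 ≤ p * (p - 1) := mul_nonneg (by linarith) (by linarith)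
  have hG : 0 ≤ ∫ t in Ioi 0, t ^ (p - 2) * (exp (-t) / 2 + SS 1 t) := by
    refine setIntegral_nonneg measurableSet_Ioi fun t ht => ?_
    have ht : 0 < t := ht
    have := SS_nonneg zero_le_one le_rfl ht.le
    have := rpow_nonneg ht.le (p - 2)
    positivity
  have R : ∫ x in Ioi (0:ℝ), |x - 1| ^ p * exp (-x)
      = p * (p - 1) * (2 / exp 1) * ∫ t in Ioi 0, t ^ (p - 2) * (exp (-t) / 2 + SS 1 t) := by
    rw [integral_eq_lintegral_of_nonneg_ae]
    · have : ∀ x : ℝ, ENNReal.ofReal (|x - 1| ^ p * exp (-x))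
          = ENNReal.ofReal (|x - 1| ^ p) * ENNReal.ofReal (exp (-x)) :=
        fun x => ENNReal.ofReal_mul (by positivity)
      simp only [this]
      rw [L, ENNReal.toReal_ofReal (by positivity)]
    · exact Filter.Eventually.of_forall fun x => by simp only [Pi.zero_apply]; positivity
    · exact Measurable.aestronglyMeasurable (by fun_prop)
  rw [R, (PP_scale zero_le_one le_rfl (by linarith)).2, ww_one, show p - 2 + 1 = p - 1 by ring,
    rpow_sub_one (by positivity)]
  have := exp_pos 1
  field_simp

lemma Gamma_two_step {p : ℝ} (hp : 1 < p) :
    Real.Gamma (p + 1) = p * (p - 1) * ∫ t in Ioi 0, t ^ (p - 2) * exp (-t) := by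
  rw [Real.Gamma_add_one (by linarith)]
  have : Real.Gamma p = (p - 1) * Real.Gamma (p - 1) := by
    have := Real.Gamma_add_one (s := p - 1) (by linarith)
    rwa [sub_add_cancel] at this
  rw [this, Real.Gamma_eq_integral (by linarith)]
  simp only [show p - 1 - 1 = p - 2 by ring, mul_comm (exp _)]
  ring

noncomputable def KK (p : ℝ) : ℝ :=
  max (Real.Gamma (p + 1)) ((exp 1 / 2) ^ p * ∫ x in Ioi (0:ℝ), |x - 1| ^ p * exp (-x))

lemma coreC {f : ℝ → ℝ} (hf : IsLogConcaveFn f) {α : ℝ} (hα : 0 < α) (hα2 : α ≤ 1 / 2)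
    (hi : IntegrableOn f (Ioi 0)) (hxi : IntegrableOn (fun x => x * f x) (Ioi 0))
    (h0 : ∫ x in Ioi 0, f x = α) (h1 : ∫ x in Ioi 0, x * f x = α)
    (gi : IntegrableOn (fun x => f (-x)) (Ioi 0))
    (gxi : IntegrableOn (fun x => x * f (-x)) (Ioi 0))
    (g0 : ∫ x in Ioi 0, f (-x) = 1 - α) (g1 : ∫ x in Ioi 0, x * f (-x) = α) {p : ℝ} (hp : 1 < p) :
    ∫⁻ x in Ioi (0:ℝ), ENNReal.ofReal (|x| ^ p) * ENNReal.ofReal (f x + f (-x))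
      ≤ ENNReal.ofReal ((2 * α) ^ p * KK p) := by
  obtain ⟨s, ⟨hs0, hs1⟩, hw, H⟩ := coreA hf hα hα2 hi hxi h0 h1 gi gxi g0 g1
  have hfm := hf.measurable
  rw [layer_cake (μ := volume.restrict (Ioi (0:ℝ))) hp (Z := fun x => |x|)
    (h := fun x => ENNReal.ofReal (f x + f (-x))) (by fun_prop) (by fun_prop) (fun x => abs_nonneg _)]
  have hpp : 0 ≤ p * (p - 1) := mul_nonneg (by linarith) (by linarith)
  have hle : ∫⁻ t in Ioi (0:ℝ), ENNReal.ofReal (p * (p - 1) * t ^ (p - 2)) *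
          ∫⁻ x in Ioi (0:ℝ), ENNReal.ofReal (|x| - t) * ENNReal.ofReal (f x + f (-x))
      ≤ ∫⁻ t in Ioi (0:ℝ), ENNReal.ofReal (p * (p - 1) * t ^ (p - 2)) *
      ENNReal.ofReal (2 * α * (exp (-t) / 2 + SS s t)) := by
    refine setLIntegral_mono' measurableSet_Ioi fun t ht => ?_
    have ht : 0 < t := ht
    gcongr
    have i1 := integrable_max (t := t) hi hxi
    have i2 := integrable_max (t := t) gi gxi
    have i3 : Integrable (fun x => max (x - t) 0 * f x + max (x - t) 0 * f (-x))
      (volume.restrict (Ioi 0)) := i1.add i2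
    refine le_trans (le_of_eq ?_) (ENNReal.ofReal_le_ofReal (H t ht.le))
    rw [← integral_add i1 i2, ofReal_integral_eq_lintegral_ofReal i3]
    · refine setLIntegral_congr_fun measurableSet_Ioi fun x hx => ?_
      have hx : 0 < x := hx
      rw [ofReal_mul_ofReal _ (add_nonneg (hf.1 _) (hf.1 _)), abs_of_pos hx, mul_add]
    · exact Filter.Eventually.of_forall fun x => add_nonneg
        (mul_nonneg (le_max_right _ _) (hf.1 _)) (mul_nonneg (le_max_right _ _) (hf.1 _))
  refine hle.trans ?_
  rw [GG_lint hs0 hs1 hp (by linarith)]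
  refine ENNReal.ofReal_le_ofReal ?_
  have hB := coreB hs0 hs1 (r := p - 2) (by linarith)
  have hB2 : p * (p - 1) * ∫ t in Ioi 0, t ^ (p - 2) * PP s t ≤ KK p := by
    refine (mul_le_mul_of_nonneg_left hB hpp).trans ?_
    rw [mul_max_of_nonneg _ _ hpp, ← M_one hp, ← Gamma_two_step hp]
    exact le_rfl
  refine le_trans (le_of_eq ?_) (mul_le_mul_of_nonneg_left hB2 (by positivity : 0 ≤ (2 * α) ^ p))
  rw [(PP_scale hs0 hs1 (by linarith)).2]
  have hwp := ww_pos hs1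
  have h2α : 2 * α = (ww s)⁻¹ := eq_inv_of_mul_eq_one_left hw
  rw [h2α, show p - 2 + 1 = p - 1 by ring, rpow_sub_one hwp.ne', inv_rpow hwp.le]
  have := (rpow_pos_of_pos hwp p).ne'
  field_simp

lemma lint_half {g : ℝ → ENNReal} (hg : Measurable g) :
    ∫⁻ x, g x = ∫⁻ x in Ioi 0, (g x + g (-x)) := by
  have hneg : ∫⁻ x in Iic 0, g x = ∫⁻ x in Ioi 0, g (-x) := by
    rw [← setLIntegral_congr (Iio_ae_eq_Iic (a := (0:ℝ))), ← lintegral_indicator measurableSet_Iio,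
      ← lintegral_indicator measurableSet_Ioi,
      ← (Measure.measurePreserving_neg (volume : Measure ℝ)).lintegral_comp
        (hg.indicator measurableSet_Iio)]
    refine lintegral_congr fun x => ?_
    by_cases h : 0 < x
    · rw [indicator_of_mem (show -x ∈ Iio 0 by simpa using h), indicator_of_mem (show x ∈ Ioi 0 from h)]
    · rw [indicator_of_notMem (show -x ∉ Iio 0 by simpa using h),
        indicator_of_notMem (show x ∉ Ioi 0 from h)]
  rw [lintegral_add_left hg, ← hneg, ← lintegral_add_compl g (measurableSet_Ioi (a := (0:ℝ))), compl_Ioi]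

lemma int_half {h : ℝ → ℝ} (hh : Integrable h) :
    ∫ x, h x = (∫ x in Ioi 0, h x) + ∫ x in Ioi 0, h (-x) := by
  rw [integral_comp_neg_Ioi, neg_zero, add_comm,
    intervalIntegral.integral_Iic_add_Ioi hh.integrableOn hh.integrableOn]

lemma lint_scale {g : ℝ → ENNReal} (hg : Measurable g) {c : ℝ} (hc : 0 < c) :
    ∫⁻ x in Ioi 0, g x = ENNReal.ofReal c * ∫⁻ x in Ioi 0, g (c * x) := by
  have hm : Measurable ((Ioi (0:ℝ)).indicator g) := hg.indicator measurableSet_Ioi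
  have e : ∫⁻ x in Ioi 0, g (c * x) = ENNReal.ofReal c⁻¹ * ∫⁻ x in Ioi 0, g x := by
    have h1 : ∫⁻ x in Ioi 0, g (c * x) = ∫⁻ x, (Ioi (0:ℝ)).indicator g (c * x) := by
      rw [← lintegral_indicator measurableSet_Ioi]
      refine lintegral_congr fun x => ?_
      by_cases h : 0 < x
      · rw [indicator_of_mem (show x ∈ Ioi 0 from h), indicator_of_mem (show c * x ∈ Ioi 0 from mul_pos hc h)]
      · rw [indicator_of_notMem (show x ∉ Ioi 0 from h), indicator_of_notMem]
        intro hh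
        exact h ((mul_pos_iff_of_pos_left hc).1 hh)
    rw [h1, ← lintegral_map (f := (Ioi (0:ℝ)).indicator g) (g := fun x => c * x) hm (by fun_prop),
      Real.map_volume_mul_left hc.ne', lintegral_smul_measure, lintegral_indicator measurableSet_Ioi,
      abs_of_pos (inv_pos.2 hc), smul_eq_mul]
  rw [e, ← mul_assoc, ← ENNReal.ofReal_mul hc.le, mul_inv_cancel₀ hc.ne', ENNReal.ofReal_one, one_mul]

lemma coreD {f : ℝ → ℝ} (hf : IsLogConcaveFn f) {a m : ℝ} (ha : 0 < a) (hm : 0 < m) (ha2 : a ≤ 1 / 2)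
    (hi : IntegrableOn f (Ioi 0)) (hxi : IntegrableOn (fun x => x * f x) (Ioi 0))
    (h0 : ∫ x in Ioi 0, f x = a) (h1 : ∫ x in Ioi 0, x * f x = m)
    (gi : IntegrableOn (fun x => f (-x)) (Ioi 0))
    (gxi : IntegrableOn (fun x => x * f (-x)) (Ioi 0))
    (g0 : ∫ x in Ioi 0, f (-x) = 1 - a) (g1 : ∫ x in Ioi 0, x * f (-x) = m) {p : ℝ} (hp : 1 < p) :
    ∫⁻ x in Ioi (0:ℝ), ENNReal.ofReal (|x| ^ p) * ENNReal.ofReal (f x + f (-x))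
      ≤ ENNReal.ofReal ((2 * m) ^ p * KK p) := by
  have hfm := hf.measurable
  set c := m / a with hc
  have hc0 : 0 < c := div_pos hm ha
  have hcm : c⁻¹ * m = a := by rw [hc]; field_simp
  have key : ∀ F : ℝ → ℝ, IntegrableOn F (Ioi 0) → IntegrableOn (fun x => F (c * x)) (Ioi 0) ∧
      ∫ x in Ioi 0, F (c * x) = c⁻¹ * ∫ x in Ioi 0, F x := by
    intro F hF
    constructor
    · rw [integrableOn_Ioi_comp_mul_left_iff F 0 hc0, mul_zero]; exact hF
    · rw [integral_comp_mul_left_Ioi F 0 hc0, mul_zero, smul_eq_mul]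
  have e1 : ∀ x, c * f (c * -x) = c * f (-(c * x)) := fun x => by rw [mul_neg]
  have e2 : ∀ x, x * (c * f (c * x)) = (c * x) * f (c * x) := fun x => by ring
  have e3 : ∀ x, x * (c * f (-(c * x))) = (c * x) * f (-(c * x)) := fun x => by ring
  obtain ⟨k1, k1'⟩ := key f hi
  obtain ⟨k2, k2'⟩ := key _ hxi
  obtain ⟨k3, k3'⟩ := key _ gi
  obtain ⟨k4, k4'⟩ := key _ gxi
  have C := coreC (f := fun x => c * f (c * x)) ((hf.comp_mul c).const_mul hc0) ha ha2
    (k1.const_mul c) (by simp only [e2]; exact k2)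
    (by rw [integral_const_mul, k1', h0]; field_simp)
    (by simp only [e2]; rw [k2', h1, hcm])
    (by simp only [e1]; exact k3.const_mul c)
    (by simp only [e1, e3]; exact k4)
    (by simp only [e1]; rw [integral_const_mul, k3', g0]; field_simp)
    (by simp only [e1, e3]; rw [k4', g1, hcm]) hp
  rw [lint_scale (by fun_prop) hc0]
  have e4 : ∀ x : ℝ, ENNReal.ofReal (|c * x| ^ p) * ENNReal.ofReal (f (c * x) + f (-(c * x)))
      = ENNReal.ofReal (c ^ p * c⁻¹) *
        (ENNReal.ofReal (|x| ^ p) * ENNReal.ofReal (c * f (c * x) + c * f (c * -x))) := by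
    intro x
    have := hf.1 (c * x)
    have := hf.1 (-(c * x))
    rw [← ENNReal.ofReal_mul (by positivity), ← ENNReal.ofReal_mul (by positivity),
      ← ENNReal.ofReal_mul (by positivity)]
    congr 1
    rw [abs_mul, abs_of_pos hc0, mul_rpow hc0.le (abs_nonneg _), mul_neg]
    field_simp
  simp only [e4]
  rw [lintegral_const_mul _ (by fun_prop), ← mul_assoc, ← ENNReal.ofReal_mul hc0.le]
  refine (mul_le_mul_right C _).trans (le_of_eq ?_)
  rw [← ENNReal.ofReal_mul (by positivity)]
  congr 1
  have : 2 * m = c * (2 * a) := by rw [hc]; field_simp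
  rw [this, mul_rpow hc0.le (by positivity)]
  field_simp

lemma coreE {f : ℝ → ℝ} (hf : IsLogConcaveFn f) (hi : Integrable f) (hi1 : ∫ x, f x = 1)
    (hx : Integrable (fun x => x * f x)) (hx0 : ∫ x, x * f x = 0) {p : ℝ} (hp : 1 < p) :
    ∫⁻ x, ENNReal.ofReal (|x| ^ p) * ENNReal.ofReal (f x)
      ≤ ENNReal.ofReal ((∫ x, |x| * f x) ^ p * KK p) := by
  have hfm := hf.measurable
  have hin : Integrable (fun x => f (-x)) := hi.comp_neg
  have hxn : Integrable (fun x => x * f (-x)) := by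
    have := hx.comp_neg.neg
    refine this.congr (Filter.Eventually.of_forall fun x => ?_)
    simp
  have habs : Integrable (fun x => |x| * f x) := by
    refine hx.norm.congr (Filter.Eventually.of_forall fun x => ?_)
    simp [abs_of_nonneg (hf.1 x)]
  have s1 := int_half hi
  have s2 := int_half hx
  have s3 := int_half habs
  have r1 : ∫ x in Ioi 0, |x| * f x = ∫ x in Ioi 0, x * f x :=
    setIntegral_congr_fun measurableSet_Ioi fun x hx => by
      simp only [abs_of_pos (show 0 < x from hx)]
  have r2 : ∫ x in Ioi 0, |-x| * f (-x) = ∫ x in Ioi 0, x * f (-x) :=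
    setIntegral_congr_fun measurableSet_Ioi fun x hx => by
      simp only [abs_neg, abs_of_pos (show 0 < x from hx)]
  have r3 : ∫ x in Ioi 0, -x * f (-x) = - ∫ x in Ioi 0, x * f (-x) := by
    simp only [neg_mul]; rw [integral_neg]
  have z : ∀ F : ℝ → ℝ, (∀ x, 0 ≤ F x) → Integrable F → Integrable (fun x => x * F x) →
      (∫ x in Ioi 0, F x = 0 ↔ ∫ x in Ioi 0, x * F x = 0) := by
    intro F hF i1 i2
    have hmem := ae_restrict_mem (μ := (volume : Measure ℝ)) (measurableSet_Ioi (a := (0:ℝ)))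
    rw [setIntegral_eq_zero_iff_of_nonneg_ae (Filter.Eventually.of_forall hF) i1.integrableOn,
      setIntegral_eq_zero_iff_of_nonneg_ae _ i2.integrableOn]
    · constructor
      · intro h
        filter_upwards [h] with x hx
        simp [hx]
      · intro h
        filter_upwards [h, hmem] with x hx hx0
        have : x ≠ 0 := (show (0:ℝ) < x from hx0).ne'
        simpa [this] using hx
    · filter_upwards [hmem] with x hx0
      exact mul_nonneg (show (0:ℝ) < x from hx0).le (hF x)
  have z1 := z f hf.1 hi hx
  have z2 := z (fun x => f (-x)) (fun x => hf.1 _) hin hxn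
  rw [r3] at s2
  rw [r1, r2] at s3
  rw [hi1] at s1
  rw [hx0] at s2
  have na : 0 ≤ ∫ x in Ioi 0, f x := integral_nonneg hf.1
  have nb : 0 ≤ ∫ x in Ioi 0, f (-x) := integral_nonneg fun x => hf.1 _
  have nm : 0 ≤ ∫ x in Ioi 0, x * f x :=
    setIntegral_nonneg measurableSet_Ioi fun x hx => mul_nonneg (show 0 < x from hx).le (hf.1 x)
  rw [lint_half (by fun_prop)]
  have eg : ∀ x : ℝ, ENNReal.ofReal (|x| ^ p) * ENNReal.ofReal (f x)
      + ENNReal.ofReal (|-x| ^ p) * ENNReal.ofReal (f (-x))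
      = ENNReal.ofReal (|x| ^ p) * ENNReal.ofReal (f x + f (-x)) := by
    intro x
    rw [abs_neg, ← mul_add, ENNReal.ofReal_add (hf.1 _) (hf.1 _)]
  simp only [eg]
  generalize ha : ∫ x in Ioi 0, f x = a at *
  generalize hb : ∫ x in Ioi 0, f (-x) = b at *
  generalize hm : ∫ x in Ioi 0, x * f x = m at *
  generalize hm' : ∫ x in Ioi 0, x * f (-x) = m' at *
  have hmm : m' = m := by linarith
  subst hmm
  have hm0 : 0 < m' := by
    refine lt_of_le_of_ne nm fun h => ?_
    have := z1.2 h.symm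
    have := z2.2 h.symm
    linarith
  have ha0 : 0 < a := lt_of_le_of_ne na fun h => hm0.ne' (z1.1 h.symm)
  have hb0 : 0 < b := lt_of_le_of_ne nb fun h => hm0.ne' (z2.1 h.symm)
  rw [s3, ← two_mul]
  rcases le_total a (1/2) with h | h
  · exact coreD hf ha0 hm0 h hi.integrableOn hx.integrableOn ha hm hin.integrableOn hxn.integrableOn
      (by linarith) hm' hp
  · have := hf.comp_mul (-1)
    simp only [neg_one_mul] at this
    have D := coreD this (a := b) hb0 hm0 (by linarith) hin.integrableOn hxn.integrableOn hb hm'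
      (by simpa using hi.integrableOn) (by simpa using hx.integrableOn) (by simp only [neg_neg]; linarith)
      (by simpa using hm) hp
    simpa only [neg_neg, add_comm (f (- _))] using D

lemma KK_rpow {p : ℝ} (hp : 1 < p) : KK p ^ (1 / p) = max (Real.Gamma (p + 1) ^ (1 / p))
        ((Real.exp 1 / 2) * (∫ x in Set.Ioi (0 : ℝ), |x - 1| ^ p * Real.exp (-x)) ^ (1 / p)) := by
  have hp0 : 0 < p := by linarith
  have h1 : 0 ≤ Real.Gamma (p + 1) := (Real.Gamma_pos_of_pos (by linarith)).le
  have hI : 0 ≤ ∫ x in Set.Ioi (0 : ℝ), |x - 1| ^ p * Real.exp (-x) :=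
    integral_nonneg fun x => by positivity
  have h2 : ((exp 1 / 2) ^ p * ∫ x in Ioi (0:ℝ), |x - 1| ^ p * exp (-x)) ^ (1 / p)
      = (Real.exp 1 / 2) * (∫ x in Set.Ioi (0 : ℝ), |x - 1| ^ p * Real.exp (-x)) ^ (1 / p) := by
    rw [mul_rpow (by positivity) hI, ← rpow_mul (by positivity), mul_one_div_cancel hp0.ne', rpow_one]
  rw [← h2]
  unfold KK
  have h3 : 0 ≤ (exp 1 / 2) ^ p * ∫ x in Ioi (0:ℝ), |x - 1| ^ p * exp (-x) := by positivity
  have hr : 0 ≤ 1 / p := by positivity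
  rcases le_total (Real.Gamma (p + 1)) ((exp 1 / 2) ^ p * ∫ x in Ioi (0:ℝ), |x - 1| ^ p * exp (-x)) with h | h
  · rw [max_eq_right h, max_eq_right (rpow_le_rpow h1 h hr)]
  · rw [max_eq_left h, max_eq_left (rpow_le_rpow h3 h hr)]

lemma KK_pos {p : ℝ} (hp : 1 < p) : 0 < KK p :=
  lt_max_of_lt_left (Real.Gamma_pos_of_pos (by linarith))

theorem stmt_2 {Ω : Type} [MeasurableSpace Ω] (P : Measure Ω) [IsProbabilityMeasure P]
    (X : Ω → ℝ) (f : ℝ → ℝ) (hf : IsLogConcaveFn f) (hX : HasDensity P X f)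
    (hmean : (∫ ω, X ω ∂P) = 0)
    (p : ℝ) (hp : 1 ≤ p) :
    pNorm P X p ≤
      max (Real.Gamma (p + 1) ^ (1 / p))
        ((Real.exp 1 / 2) * (∫ x in Set.Ioi (0 : ℝ), |x - 1| ^ p * Real.exp (-x)) ^ (1 / p)) *
      pNorm P X 1 := by
  have hn1 : pNorm P X 1 = ∫ ω, |X ω| ∂P := by simp [pNorm]
  have hA : 0 ≤ ∫ ω, |X ω| ∂P := integral_nonneg fun ω => abs_nonneg _
  rcases hp.eq_or_lt with rfl | hp1
  · refine le_mul_of_one_le_left (by rw [hn1]; exact hA) (le_max_of_le_left ?_)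
    norm_num
  have hp0 : 0 < p := by linarith
  rw [← KK_rpow hp1, hn1]
  have hnp : pNorm P X p = (∫ ω, |X ω| ^ p ∂P) ^ (1 / p) := by simp [pNorm, hp0.ne']
  rw [hnp]
  obtain ⟨hXm, hmap⟩ := hX
  have hfm := hf.measurable
  have hfe : Measurable fun x => ENNReal.ofReal (f x) := by fun_prop
  have hKp := KK_pos hp1
  suffices h : ∫ ω, |X ω| ^ p ∂P ≤ (∫ ω, |X ω| ∂P) ^ p * KK p by
    refine (rpow_le_rpow (integral_nonneg fun ω => by positivity) h (by positivity)).trans (le_of_eq ?_)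
    rw [mul_rpow (by positivity) hKp.le, ← rpow_mul hA, mul_one_div_cancel hp0.ne', rpow_one, mul_comm]
  by_cases hint : Integrable X P
  swap
  · have : ¬ Integrable (fun ω => |X ω| ^ p) P := by
      intro hh
      apply hint
      refine Integrable.mono' ((integrable_const (1:ℝ)).add hh) hXm.aestronglyMeasurable ?_
      refine Filter.Eventually.of_forall fun ω => ?_
      simp only [Real.norm_eq_abs, Pi.add_apply]
      rcases le_total |X ω| 1 with h | h
      · have : 0 ≤ |X ω| ^ p := by positivity
        linarith
      · have := Real.rpow_le_rpow_of_exponent_le h hp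
        rw [rpow_one] at this
        linarith
    rw [integral_undef this]
    positivity
  have hlt : ∀ᵐ x ∂(volume : Measure ℝ), ENNReal.ofReal (f x) < ⊤ :=
    Filter.Eventually.of_forall fun x => ENNReal.ofReal_lt_top
  -- transfer to the density
  have t1 : ∀ g : ℝ → ENNReal, Measurable g →
      ∫⁻ ω, g (X ω) ∂P = ∫⁻ x, g x * ENNReal.ofReal (f x) := by
    intro g hg
    rw [← lintegral_map hg hXm, hmap, lintegral_withDensity_eq_lintegral_mul _ hfe hg]
    simp only [Pi.mul_apply, mul_comm]
  have t2 : ∀ g : ℝ → ℝ, Measurable g → ∫ ω, g (X ω) ∂P = ∫ x, g x * f x := by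
    intro g hg
    rw [← integral_map hXm.aemeasurable hg.aestronglyMeasurable, hmap,
      integral_withDensity_eq_integral_toReal_smul hfe hlt]
    simp only [ENNReal.toReal_ofReal (hf.1 _), smul_eq_mul, mul_comm]
  have t3 : ∀ g : ℝ → ℝ, Measurable g → Integrable (fun ω => g (X ω)) P →
      Integrable (fun x => g x * f x) := by
    intro g hg hh
    have : Integrable g (Measure.map X P) :=
      (integrable_map_measure hg.aestronglyMeasurable hXm.aemeasurable).2 hh
    rw [hmap, integrable_withDensity_iff_integrable_smul' hfe hlt] at this
    simpa only [ENNReal.toReal_ofReal (hf.1 _), smul_eq_mul, mul_comm] using this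
  have hi : Integrable f := by
    simpa using t3 (fun _ => 1) measurable_const (integrable_const 1)
  have hi1 : ∫ x, f x = 1 := by
    have := t2 (fun _ => 1) measurable_const
    simpa using this.symm
  have hx := t3 (fun x => x) measurable_id hint
  have hx0 := t2 (fun x => x) measurable_id
  rw [hmean] at hx0
  have E := coreE hf hi hi1 hx hx0.symm hp1
  rw [← t2 (fun x => |x|) (by fun_prop), ← t1 (fun x => ENNReal.ofReal (|x| ^ p)) (by fun_prop)] at E
  rw [integral_eq_lintegral_of_nonneg_ae (Filter.Eventually.of_forall fun ω => by
    simp only [Pi.zero_apply]; positivity)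
    (Measurable.aestronglyMeasurable (by fun_prop))]
  refine ENNReal.toReal_le_of_le_ofReal (by positivity) E
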